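/- arXiv:1411.7747 — 3 statements merged into one kernel-verified Lean document; each statement's English description precedes it below -/
import Mathlib

section
/- There exist an absolute constant C > 0 and a constant C_k > 0 depending only on k such that the following holds. Let G be a Label-Cover instance (bi-regular, with R = dL and d-regular projection fibers) satisfying c₀-smoothness for a constant c₀ ∈ (0, 1/3), let ε ∈ (0, 1/2], and suppose every labeling of G satisfies at most an s fraction of edges. Then for every family of functions {g_v : {−1,1}^{2R} → {−1,1}}_{v∈V} (in particular for g_v = f_{S,v} := Π_{i∈S} f_{i,v} arising from any t assignments and any nonempty S ⊆ {1, …, t}): E_{u,v,w} E_{(X,Y)∼𝒯₂}[ Π_{j=1}^k g_v(x_j) g_w(y_j) ] ≥ − C·k·s^{c₀/8} − C_k · s^{(1−3c₀)/8} / ε^{3/(2c₀)}. -/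
open Finset

/-! Common setup for the long code test `𝒯₂` of Dinur–Kol / this paper.

A Label-Cover instance consists of a bipartite graph on `U × V` given by a Boolean
adjacency relation `Adj`, with projections `π u v : Fin R → Fin L`; we assume `R = d·L`
and that all fibers `π_{uv}^{-1}(i)` have size `d`.  Long-code strings in `{0,1}^{2R}`
are indexed by `Fin R ⊕ Fin R` (`Sum.inl j` is position `j ∈ [R]`, `Sum.inr j` is
position `j + R`). -/

/-- Choose `P1` if `b = true`, else `P0`. -/
def pick {k : ℕ} (P0 P1 : (Fin k → Bool) → ℝ) (b : Bool) : (Fin k → Bool) → ℝ :=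
  if b = true then P1 else P0

/-- The fiber `π_{uv}^{-1}(i) ⊆ [R]`. -/
def fib {U V : Type} {L R : ℕ} (π : U → V → Fin R → Fin L) (u : U) (v : V) (i : Fin L) :
    Finset (Fin R) :=
  univ.filter (fun j => π u v j = i)

/-- Mass contributed by block `i ∈ [L]` of the test `𝒯₂` for fixed `u, v, w`:
a uniform bit `c₁` decides whether the `X`-columns of the block (of both halves,
`B_{uv}(i)` and `B'_{uv}(i)`) are i.i.d. `𝒫₀` and the `Y`-columns i.i.d. `𝒫₁`, or vice
versa; then independently with probability `1 − 2ε` nothing is changed, with probability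
`ε` the primed halves `(X|_{B'_{uv}(i)}, Y|_{B'_{uw}(i)})` are resampled uniformly, and
with probability `ε` the unprimed halves are resampled uniformly. -/
noncomputable def blockM {U V : Type} {k L R : ℕ} (π : U → V → Fin R → Fin L)
    (ε : ℝ) (P0 P1 : (Fin k → Bool) → ℝ) (d : ℕ) (u : U) (v w : V) (i : Fin L)
    (X Y : Fin k → (Fin R ⊕ Fin R) → Bool) : ℝ :=
  (1 / 2) * ∑ b : Bool,
    ((1 - 2 * ε) *
        ((∏ j ∈ fib π u v i,
            pick P0 P1 b (fun r => X r (Sum.inl j)) * pick P0 P1 b (fun r => X r (Sum.inr j))) *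
         (∏ j ∈ fib π u w i,
            pick P0 P1 (!b) (fun r => Y r (Sum.inl j)) * pick P0 P1 (!b) (fun r => Y r (Sum.inr j))))
     + ε * ((∏ j ∈ fib π u v i, pick P0 P1 b (fun r => X r (Sum.inl j))) *
            (∏ j ∈ fib π u w i, pick P0 P1 (!b) (fun r => Y r (Sum.inl j)))) *
          ((1 : ℝ) / 2 ^ k) ^ (2 * d)
     + ε * ((∏ j ∈ fib π u v i, pick P0 P1 b (fun r => X r (Sum.inr j))) *
            (∏ j ∈ fib π u w i, pick P0 P1 (!b) (fun r => Y r (Sum.inr j)))) *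
          ((1 : ℝ) / 2 ^ k) ^ (2 * d))

/-- Mass of the pair of matrices `(X, Y)` under the test `𝒯₂` for fixed `u, v, w`:
the blocks `i ∈ [L]` are independent. -/
noncomputable def massT2 {U V : Type} {k L R : ℕ} (π : U → V → Fin R → Fin L)
    (ε : ℝ) (P0 P1 : (Fin k → Bool) → ℝ) (d : ℕ) (u : U) (v w : V)
    (X Y : Fin k → (Fin R ⊕ Fin R) → Bool) : ℝ :=
  ∏ i : Fin L, blockM π ε P0 P1 d u v w i X Y

/-- Expectation over `(X, Y) ∼ 𝒯₂` (for fixed `u, v, w`) of a function of the two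
matrices. -/
noncomputable def ET2 {U V : Type} {k L R : ℕ} (π : U → V → Fin R → Fin L)
    (ε : ℝ) (P0 P1 : (Fin k → Bool) → ℝ) (d : ℕ) (u : U) (v w : V)
    (h : (Fin k → (Fin R ⊕ Fin R) → Bool) → (Fin k → (Fin R ⊕ Fin R) → Bool) → ℝ) : ℝ :=
  ∑ X : Fin k → (Fin R ⊕ Fin R) → Bool, ∑ Y : Fin k → (Fin R ⊕ Fin R) → Bool,
    massT2 π ε P0 P1 d u v w X Y * h X Y

/-- The neighbors of `u ∈ U` in the bipartite graph. -/
def nbr {U V : Type} [Fintype V] (Adj : U → V → Bool) (u : U) : Finset V :=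
  univ.filter (fun v => Adj u v = true)

/-- Expectation over a uniform `u ∈ U` and uniform independent neighbors `v, w` of `u`. -/
noncomputable def Euvw {U V : Type} [Fintype U] [Fintype V] (Adj : U → V → Bool)
    (h : U → V → V → ℝ) : ℝ :=
  (1 / (Fintype.card U : ℝ)) * ∑ u : U, (1 / ((nbr Adj u).card : ℝ) ^ 2) *
    ∑ v ∈ nbr Adj u, ∑ w ∈ nbr Adj u, h u v w

/-- The Fourier character `χ_β` on `{0,1}^{2R}` (bits identified with `±1`). -/
def chi {R : ℕ} (β : Finset (Fin R ⊕ Fin R)) (x : (Fin R ⊕ Fin R) → Bool) : ℝ :=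
  ∏ c ∈ β, (if x c = true then (-1 : ℝ) else 1)

/-- The Fourier coefficient `f̂(β)` of `f : {0,1}^{2R} → ℝ` over the uniform
distribution. -/
noncomputable def fhat {R : ℕ} (f : ((Fin R ⊕ Fin R) → Bool) → ℝ)
    (β : Finset (Fin R ⊕ Fin R)) : ℝ :=
  (∑ x : (Fin R ⊕ Fin R) → Bool, f x * chi β x) / (2 : ℝ) ^ (2 * R)

/-- The noise operator `T_{1-γ} f = Σ_β (1-γ)^{|β|} f̂(β) χ_β`. -/
noncomputable def noiseT {R : ℕ} (γ : ℝ) (f : ((Fin R ⊕ Fin R) → Bool) → ℝ) :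
    ((Fin R ⊕ Fin R) → Bool) → ℝ :=
  fun x => ∑ β : Finset (Fin R ⊕ Fin R), (1 - γ) ^ β.card * fhat f β * chi β x

/-- `π̃_{uv}(β) := {i ∈ [L] : ∃ j ∈ [R], (j ∈ β ∨ j + R ∈ β) ∧ π_{uv}(j) = i}`. -/
def ptil {U V : Type} {L R : ℕ} (π : U → V → Fin R → Fin L) (u : U) (v : V)
    (β : Finset (Fin R ⊕ Fin R)) : Finset (Fin L) :=
  univ.filter (fun i => ∃ j : Fin R, (Sum.inl j ∈ β ∨ Sum.inr j ∈ β) ∧ π u v j = i)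

/-- The grouped influence `Inf̄ᵘ_i[f] = Σ_{α : i ∈ π̃_{uv}(α)} f̂(α)²`. -/
noncomputable def gInf {U V : Type} {L R : ℕ} (π : U → V → Fin R → Fin L) (u : U) (v : V)
    (f : ((Fin R ⊕ Fin R) → Bool) → ℝ) (i : Fin L) : ℝ :=
  ∑ β ∈ univ.filter (fun β : Finset (Fin R ⊕ Fin R) => i ∈ ptil π u v β), (fhat f β) ^ 2

set_option linter.unusedSectionVars false

section Fourier

variable {N : Type} [Fintype N] [DecidableEq N]

/-- The sign `(-1)^b` of a bit. -/
noncomputable def bitSign (b : Bool) : ℝ := if b = true then -1 else 1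

lemma bitSign_not (b : Bool) : bitSign (!b) = -bitSign b := by
  cases b <;> simp [bitSign]

lemma bitSign_mul_self (b : Bool) : bitSign b * bitSign b = 1 := by
  cases b <;> simp [bitSign]

/-- The Walsh character of a finite set of coordinates. -/
noncomputable def walsh (β : Finset N) (x : N → Bool) : ℝ := ∏ a ∈ β, bitSign (x a)

/-- The Walsh–Fourier coefficient with respect to the uniform distribution. -/
noncomputable def walshCoeff (f : (N → Bool) → ℝ) (β : Finset N) : ℝ :=
  (∑ x, f x * walsh β x) / 2 ^ Fintype.card N

/-- The mean with respect to the uniform distribution on the cube. -/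
noncomputable def cubeMean (f : (N → Bool) → ℝ) : ℝ := (∑ x, f x) / 2 ^ Fintype.card N

/-- Flip the bit at position `a`. -/
def flipBit (a : N) (x : N → Bool) : N → Bool := Function.update x a (!x a)

lemma flipBit_flipBit (a : N) (x : N → Bool) : flipBit a (flipBit a x) = x := by
  funext b
  by_cases h : b = a
  · subst h; simp [flipBit]
  · simp [flipBit, h]

lemma walsh_eq_prod_univ (β : Finset N) (x : N → Bool) :
    walsh β x = ∏ a, if a ∈ β then bitSign (x a) else 1 := by
  simp [walsh, Finset.prod_ite_mem]

lemma sum_walsh_mul_walsh (x y : N → Bool) :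
    ∑ β : Finset N, walsh β x * walsh β y = if x = y then 2 ^ Fintype.card N else 0 := by
  have h : ∑ β : Finset N, walsh β x * walsh β y = ∏ a, (1 + bitSign (x a) * bitSign (y a)) := by
    rw [Finset.prod_one_add]
    simp [walsh, Finset.prod_mul_distrib]
  rw [h]
  split_ifs with hxy
  · subst hxy
    simp only [bitSign_mul_self]
    norm_num [Finset.card_univ]
  · obtain ⟨a, ha⟩ := Function.ne_iff.mp hxy
    apply Finset.prod_eq_zero (mem_univ a)
    cases hx : x a <;> cases hy : y a <;> simp_all [bitSign]

lemma sum_walsh_walsh (β β' : Finset N) :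
    ∑ x : N → Bool, walsh β x * walsh β' x = if β = β' then 2 ^ Fintype.card N else 0 := by
  have h : ∑ x : N → Bool, walsh β x * walsh β' x
      = ∏ a, ∑ b : Bool, (if a ∈ β then bitSign b else 1) * (if a ∈ β' then bitSign b else 1) := by
    rw [Finset.prod_univ_sum, Fintype.piFinset_univ]
    simp only [walsh_eq_prod_univ, Finset.prod_mul_distrib]
  rw [h]
  split_ifs with hb
  · subst hb
    rw [Finset.prod_congr rfl (g := fun _ => (2 : ℝ))]
    · simp [Finset.card_univ]
    · intro a _
      by_cases ha : a ∈ β <;> simp [ha, bitSign] <;> norm_num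
  · obtain ⟨a, ha⟩ : ∃ a, ¬ (a ∈ β ↔ a ∈ β') := by
      by_contra hcon
      push Not at hcon
      exact hb (Finset.ext hcon)
    apply Finset.prod_eq_zero (mem_univ a)
    by_cases h1 : a ∈ β <;> by_cases h2 : a ∈ β' <;> simp_all [bitSign]

lemma walsh_inversion (f : (N → Bool) → ℝ) (x : N → Bool) :
    f x = ∑ β, walshCoeff f β * walsh β x := by
  have h : ∑ β, walshCoeff f β * walsh β x
      = (∑ y, f y * ∑ β : Finset N, walsh β y * walsh β x) / 2 ^ Fintype.card N := by
    simp only [walshCoeff, div_mul_eq_mul_div, ← Finset.sum_div, Finset.sum_mul, Finset.mul_sum]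
    rw [Finset.sum_comm]
    simp only [mul_assoc]
  rw [h]
  simp [sum_walsh_mul_walsh]

lemma cubeMean_sq_walsh_sum (S : Finset (Finset N)) (c : Finset N → ℝ) :
    cubeMean (fun x => (∑ β ∈ S, c β * walsh β x) ^ 2) = ∑ β ∈ S, c β ^ 2 := by
  have h : ∑ x : N → Bool, (∑ β ∈ S, c β * walsh β x) ^ 2
      = ∑ β ∈ S, ∑ β' ∈ S, c β * c β' * ∑ x : N → Bool, walsh β x * walsh β' x := by
    simp only [sq, Finset.sum_mul_sum]
    rw [Finset.sum_comm]
    refine Finset.sum_congr rfl fun β _ => ?_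
    rw [Finset.sum_comm]
    simp only [Finset.mul_sum]
    refine Finset.sum_congr rfl fun β' _ => Finset.sum_congr rfl fun x _ => ?_
    ring
  rw [cubeMean, h, div_eq_iff (by positivity), Finset.sum_mul]
  refine Finset.sum_congr rfl fun β hβ => ?_
  simp [sum_walsh_walsh, hβ, sq]

lemma parseval (f : (N → Bool) → ℝ) : cubeMean (fun x => f x ^ 2) = ∑ β, walshCoeff f β ^ 2 := by
  rw [← cubeMean_sq_walsh_sum]
  simp only [← walsh_inversion]

lemma sum_comp_flipBit (a : N) (f : (N → Bool) → ℝ) : ∑ x, f (flipBit a x) = ∑ x, f x :=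
  Equiv.sum_comp (Function.Involutive.toPerm (flipBit a) (flipBit_flipBit a)) f

lemma walsh_flipBit (a : N) (β : Finset N) (x : N → Bool) :
    walsh β (flipBit a x) = (if a ∈ β then -1 else 1) * walsh β x := by
  have h : ∀ b ∈ β, bitSign (flipBit a x b) = (if b = a then -1 else 1) * bitSign (x b) := by
    intro b _
    by_cases hb : b = a
    · subst hb; simp [flipBit, bitSign_not]
    · simp [flipBit, hb]
  rw [walsh, Finset.prod_congr rfl h, Finset.prod_mul_distrib, ← walsh, Finset.prod_ite_eq']

/-- The even part of `f` in coordinate `a`. -/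
noncomputable def evenPart (a : N) (f : (N → Bool) → ℝ) (x : N → Bool) : ℝ :=
  (f x + f (flipBit a x)) / 2

/-- The odd part of `f` in coordinate `a`. -/
noncomputable def oddPart (a : N) (f : (N → Bool) → ℝ) (x : N → Bool) : ℝ :=
  (f x - f (flipBit a x)) / 2

/-- The influence of coordinate `a` on `f`. -/
noncomputable def influence (a : N) (f : (N → Bool) → ℝ) : ℝ :=
  cubeMean (fun x => oddPart a f x ^ 2)

lemma walshCoeff_oddPart (a : N) (f : (N → Bool) → ℝ) (β : Finset N) :
    walshCoeff (oddPart a f) β = if a ∈ β then walshCoeff f β else 0 := by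
  have h : ∑ x, f (flipBit a x) * walsh β x
      = (if a ∈ β then -1 else 1) * ∑ x, f x * walsh β x := by
    rw [← sum_comp_flipBit a, Finset.mul_sum]
    refine Finset.sum_congr rfl fun x _ => ?_
    rw [flipBit_flipBit, walsh_flipBit]
    ring
  have h2 : ∑ x, oddPart a f x * walsh β x
      = (∑ x, f x * walsh β x - ∑ x, f (flipBit a x) * walsh β x) / 2 := by
    rw [← Finset.sum_sub_distrib, Finset.sum_div]
    refine Finset.sum_congr rfl fun x _ => ?_
    rw [oddPart]; ring
  rw [walshCoeff, h2, h]
  split_ifs <;> simp [walshCoeff]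

lemma influence_nonneg (a : N) (f : (N → Bool) → ℝ) : 0 ≤ influence a f := by
  unfold influence cubeMean; positivity

lemma sum_influence (f : (N → Bool) → ℝ) :
    ∑ a, influence a f = ∑ β, (β.card : ℝ) * walshCoeff f β ^ 2 := by
  simp only [influence, parseval, walshCoeff_oddPart]
  rw [Finset.sum_comm]
  refine Finset.sum_congr rfl fun β _ => ?_
  simp [ite_pow, Finset.sum_ite_mem]

/-- The transition probability of a bit under the noise operator `T_{1-γ}`. -/
noncomputable def bitKernel (γ : ℝ) (b b' : Bool) : ℝ := if b = b' then 1 - γ / 2 else γ / 2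

/-- The noise operator `T_{1-γ}`, as an average over rerandomized inputs. -/
noncomputable def smoothing (γ : ℝ) (f : (N → Bool) → ℝ) (x : N → Bool) : ℝ :=
  ∑ y, (∏ a, bitKernel γ (x a) (y a)) * f y

lemma abs_smoothing_le {γ : ℝ} (h0 : 0 ≤ γ) (h1 : γ ≤ 1) {f : (N → Bool) → ℝ}
    (hf : ∀ x, |f x| ≤ 1) (x : N → Bool) : |smoothing γ f x| ≤ 1 := by
  have hK : ∀ b b', 0 ≤ bitKernel γ b b' := by
    intro b b'; unfold bitKernel; split_ifs <;> linarith
  have hsum : ∑ y : N → Bool, ∏ a, bitKernel γ (x a) (y a) = 1 := by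
    have := Finset.prod_univ_sum (fun _ : N => (univ : Finset Bool))
      (fun a b => bitKernel γ (x a) b)
    rw [Fintype.piFinset_univ] at this
    rw [← this]
    refine Finset.prod_eq_one fun a _ => ?_
    cases x a <;> simp [bitKernel]
  calc |smoothing γ f x| ≤ ∑ y, |(∏ a, bitKernel γ (x a) (y a)) * f y| :=
        Finset.abs_sum_le_sum_abs _ _
    _ ≤ ∑ y : N → Bool, ∏ a, bitKernel γ (x a) (y a) := by
        refine Finset.sum_le_sum fun y _ => ?_
        have hp : 0 ≤ ∏ a, bitKernel γ (x a) (y a) := Finset.prod_nonneg fun a _ => hK _ _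
        rw [abs_mul, abs_of_nonneg hp]
        exact mul_le_of_le_one_right hp (hf y)
    _ = 1 := hsum

lemma walshCoeff_smoothing (γ : ℝ) (f : (N → Bool) → ℝ) (β : Finset N) :
    walshCoeff (smoothing γ f) β = (1 - γ) ^ β.card * walshCoeff f β := by
  have hinner : ∀ y : N → Bool, ∑ x : N → Bool, (∏ a, bitKernel γ (x a) (y a)) * walsh β x
      = (1 - γ) ^ β.card * walsh β y := by
    intro y
    have := Finset.prod_univ_sum (fun _ : N => (univ : Finset Bool))
      (fun a b => bitKernel γ b (y a) * if a ∈ β then bitSign b else 1)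
    rw [Fintype.piFinset_univ] at this
    simp only [walsh_eq_prod_univ, ← Finset.prod_mul_distrib]
    rw [← this, ← Finset.prod_const, ← Finset.prod_ite_mem_eq β, ← Finset.prod_mul_distrib]
    refine Finset.prod_congr rfl fun a _ => ?_
    by_cases ha : a ∈ β <;> cases y a <;> simp [ha, bitKernel, bitSign] <;> ring
  have : ∑ x, smoothing γ f x * walsh β x = (1 - γ) ^ β.card * ∑ y, f y * walsh β y := by
    simp only [smoothing, Finset.sum_mul, Finset.mul_sum]
    rw [Finset.sum_comm]
    refine Finset.sum_congr rfl fun y _ => ?_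
    rw [mul_left_comm, ← hinner, Finset.mul_sum]
    refine Finset.sum_congr rfl fun x _ => ?_
    ring
  rw [walshCoeff, this, walshCoeff, mul_div_assoc]

lemma walshCoeff_sub (f g : (N → Bool) → ℝ) (β : Finset N) :
    walshCoeff (fun x => f x - g x) β = walshCoeff f β - walshCoeff g β := by
  simp [walshCoeff, sub_mul, Finset.sum_sub_distrib, sub_div]

lemma pow_one_sub_mul_le {γ : ℝ} (h0 : 0 ≤ γ) (h1 : γ ≤ 1) (m : ℕ) :
    (1 - γ) ^ m * (γ * m) ≤ 1 := by
  have hb : 1 + (m : ℝ) * γ ≤ (1 + γ) ^ m := one_add_mul_le_pow (by linarith) m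
  have h2 : (1 - γ) ^ m * (1 + γ) ^ m ≤ 1 := by
    rw [← mul_pow]
    exact pow_le_one₀ (by nlinarith) (by nlinarith)
  have h3 : 0 ≤ (1 - γ) ^ m := pow_nonneg (by linarith) m
  nlinarith [mul_le_mul_of_nonneg_left hb h3]

lemma sum_walshCoeff_sq_eq_one {f : (N → Bool) → ℝ} (hf : ∀ x, f x = 1 ∨ f x = -1) :
    ∑ β, walshCoeff f β ^ 2 = 1 := by
  rw [← parseval]
  have : ∀ x, f x ^ 2 = 1 := by
    intro x; rcases hf x with h | h <;> simp [h]
  simp [cubeMean, this]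

lemma sum_influence_smoothing_le {γ : ℝ} (h0 : 0 ≤ γ) (h1 : γ ≤ 1) {f : (N → Bool) → ℝ}
    (hf : ∀ x, f x = 1 ∨ f x = -1) : γ * ∑ a, influence a (smoothing γ f) ≤ 1 := by
  rw [sum_influence, Finset.mul_sum, ← sum_walshCoeff_sq_eq_one hf]
  refine Finset.sum_le_sum fun β _ => ?_
  rw [walshCoeff_smoothing]
  have h2 := pow_one_sub_mul_le h0 h1 β.card
  have h3 : 0 ≤ (1 - γ) ^ β.card := pow_nonneg (by linarith) _
  have h4 : (1 - γ) ^ β.card ≤ 1 := pow_le_one₀ (by linarith) (by linarith)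
  have h5 : (1 - γ) ^ β.card * ((1 - γ) ^ β.card * (γ * β.card)) ≤ 1 := by
    nlinarith [mul_le_mul_of_nonneg_left h2 h3]
  nlinarith [mul_le_mul_of_nonneg_right h5 (sq_nonneg (walshCoeff f β))]

end Fourier

section Columns

variable {N : Type} [Fintype N] [DecidableEq N] {k : ℕ}

/-- Row `j` of the matrix with columns `Z`. -/
def row (Z : N → Fin k → Bool) (j : Fin k) : N → Bool := fun a => Z a j

/-- The expectation of `F` over a matrix whose columns are independent with laws `D a`. -/
noncomputable def colE (D : N → (Fin k → Bool) → ℝ) (F : (N → Fin k → Bool) → ℝ) : ℝ :=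
  ∑ Z, (∏ a, D a (Z a)) * F Z

/-- A probability distribution on `{0,1}^k` with uniform coordinate marginals. -/
structure UniformMarginals (P : (Fin k → Bool) → ℝ) : Prop where
  nonneg : ∀ z, 0 ≤ P z
  sum_eq_one : ∑ z, P z = 1
  marginal : ∀ (j : Fin k) (b : Bool), ∑ z ∈ univ.filter (fun z : Fin k → Bool => z j = b), P z = 1 / 2

lemma UniformMarginals.sum_mul_bitSign {P : (Fin k → Bool) → ℝ} (h : UniformMarginals P)
    (j : Fin k) : ∑ z, P z * bitSign (z j) = 0 := by
  have h1 := h.marginal j true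
  have h2 := h.marginal j false
  rw [Finset.sum_filter] at h1 h2
  have : ∑ z, P z * bitSign (z j)
      = (∑ z, if z j = false then P z else 0) - ∑ z, if z j = true then P z else 0 := by
    rw [← Finset.sum_sub_distrib]
    refine Finset.sum_congr rfl fun z _ => ?_
    cases z j <;> simp [bitSign]
  rw [this, h1, h2, sub_self]

lemma UniformMarginals.uniform : UniformMarginals (fun _ : Fin k → Bool => (1 : ℝ) / 2 ^ k) where
  nonneg _ := by positivity
  sum_eq_one := by simp
  marginal j b := by
    have hflip : ∑ z ∈ univ.filter (fun z : Fin k → Bool => z j = b), (1 : ℝ) / 2 ^ k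
        = ∑ z ∈ univ.filter (fun z : Fin k → Bool => z j = !b), (1 : ℝ) / 2 ^ k := by
      refine Finset.sum_nbij' (flipBit j) (flipBit j) ?_ ?_ ?_ ?_ ?_
      · intro z hz; simp_all [flipBit]
      · intro z hz; simp_all [flipBit]
      · intro z _; exact flipBit_flipBit j z
      · intro z _; exact flipBit_flipBit j z
      · intro z _; rfl
    have htot : ∑ z : Fin k → Bool, (1 : ℝ) / 2 ^ k = 1 := by simp
    rw [← Finset.sum_filter_add_sum_filter_not univ (fun z : Fin k → Bool => z j = b)] at htot
    have hnot : univ.filter (fun z : Fin k → Bool => ¬ z j = b)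
        = univ.filter (fun z : Fin k → Bool => z j = !b) := by
      ext z; cases hz : z j <;> cases b <;> simp [hz]
    rw [hnot, ← hflip] at htot
    linarith

variable {D D' : N → (Fin k → Bool) → ℝ}

lemma colE_sum {ι : Type} (s : Finset ι) (F : ι → (N → Fin k → Bool) → ℝ) :
    colE D (fun Z => ∑ t ∈ s, F t Z) = ∑ t ∈ s, colE D (F t) := by
  simp only [colE, Finset.mul_sum]
  exact Finset.sum_comm

lemma colE_const_mul (c : ℝ) (F : (N → Fin k → Bool) → ℝ) :
    colE D (fun Z => c * F Z) = c * colE D F := by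
  simp only [colE, Finset.mul_sum]
  exact Finset.sum_congr rfl fun Z _ => by ring

lemma colE_sub (F G : (N → Fin k → Bool) → ℝ) :
    colE D (fun Z => F Z - G Z) = colE D F - colE D G := by
  simp only [colE, mul_sub, Finset.sum_sub_distrib]

lemma colE_mono (hD : ∀ a, UniformMarginals (D a)) {F G : (N → Fin k → Bool) → ℝ}
    (h : ∀ Z, F Z ≤ G Z) : colE D F ≤ colE D G :=
  Finset.sum_le_sum fun Z _ =>
    mul_le_mul_of_nonneg_left (h Z) (Finset.prod_nonneg fun a _ => (hD a).nonneg _)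

lemma abs_colE_le (hD : ∀ a, UniformMarginals (D a)) (F : (N → Fin k → Bool) → ℝ) :
    |colE D F| ≤ colE D (fun Z => |F Z|) := by
  refine (Finset.abs_sum_le_sum_abs _ _).trans (le_of_eq ?_)
  refine Finset.sum_congr rfl fun Z _ => ?_
  rw [abs_mul, abs_of_nonneg (Finset.prod_nonneg fun a _ => (hD a).nonneg _)]

/-- Each row of a matrix with independent columns of uniform marginals is uniform. -/
lemma colE_row (hD : ∀ a, UniformMarginals (D a)) (j : Fin k) (φ : (N → Bool) → ℝ) :
    colE D (fun Z => φ (row Z j)) = cubeMean φ := by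
  have h1 : ∀ Z : N → Fin k → Bool,
      φ (row Z j) = ∑ x : N → Bool, φ x * ∏ a, if Z a j = x a then 1 else 0 := by
    intro Z
    rw [Finset.sum_eq_single (row Z j)]
    · simp [row]
    · intro x _ hx
      obtain ⟨a, ha⟩ := Function.ne_iff.mp hx
      rw [Finset.prod_eq_zero (mem_univ a), mul_zero]
      rw [if_neg]
      exact fun h => ha h.symm
    · simp
  have h2 : ∀ x : N → Bool,
      ∑ Z : N → Fin k → Bool, (∏ a, D a (Z a)) * ∏ a, (if Z a j = x a then (1 : ℝ) else 0)
        = (1 / 2) ^ Fintype.card N := by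
    intro x
    have := Finset.prod_univ_sum (fun _ : N => (univ : Finset (Fin k → Bool)))
      (fun a z => D a z * if z j = x a then 1 else 0)
    rw [Fintype.piFinset_univ] at this
    simp only [← Finset.prod_mul_distrib]
    rw [← this, Finset.prod_congr rfl (g := fun _ => (1 / 2 : ℝ))]
    · simp [Finset.card_univ]
    · intro a _
      rw [← (hD a).marginal j (x a), Finset.sum_filter]
      simp
  simp only [colE, h1, Finset.mul_sum]
  rw [Finset.sum_comm, cubeMean, Finset.sum_div]
  refine Finset.sum_congr rfl fun x _ => ?_
  rw [div_eq_mul_inv, ← inv_pow, inv_eq_one_div, ← h2 x, Finset.mul_sum]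
  refine Finset.sum_congr rfl fun Z _ => ?_
  ring

lemma colE_const (hD : ∀ a, UniformMarginals (D a)) (j : Fin k) (c : ℝ) :
    colE D (fun _ => c) = c := by
  rw [colE_row hD j (fun _ => c)]
  simp [cubeMean]

/-- Flip the entry of row `j` in column `a`. -/
def flipEntry (a : N) (j : Fin k) (Z : N → Fin k → Bool) : N → Fin k → Bool :=
  Function.update Z a (flipBit j (Z a))

lemma flipEntry_flipEntry (a : N) (j : Fin k) (Z : N → Fin k → Bool) :
    flipEntry a j (flipEntry a j Z) = Z := by
  simp [flipEntry, flipBit_flipBit]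

lemma row_flipEntry_self (a : N) (j : Fin k) (Z : N → Fin k → Bool) :
    row (flipEntry a j Z) j = flipBit a (row Z j) := by
  funext b
  by_cases hb : b = a
  · subst hb; simp [row, flipEntry, flipBit]
  · simp [row, flipEntry, flipBit, hb]

lemma row_flipEntry_of_ne (a : N) {i j : Fin k} (h : i ≠ j) (Z : N → Fin k → Bool) :
    row (flipEntry a j Z) i = row Z i := by
  funext b
  by_cases hb : b = a
  · subst hb; simp [row, flipEntry, flipBit, h]
  · simp [row, flipEntry, hb]

/-- A function that changes sign with an entry of a uniform column has mean zero. -/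
lemma colE_eq_zero_of_flipEntry {a : N} (ha : ∀ z, D a z = 1 / 2 ^ k) (j : Fin k)
    {F : (N → Fin k → Bool) → ℝ} (hF : ∀ Z, F (flipEntry a j Z) = -F Z) : colE D F = 0 := by
  have h1 : colE D F = ∑ Z, (∏ b, D b (flipEntry a j Z b)) * F (flipEntry a j Z) :=
    (Equiv.sum_comp (Function.Involutive.toPerm (flipEntry a j) (flipEntry_flipEntry a j))
      (fun Z => (∏ b, D b (Z b)) * F Z)).symm
  have h2 : ∀ Z : N → Fin k → Bool, ∏ b, D b (flipEntry a j Z b) = ∏ b, D b (Z b) := by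
    intro Z
    refine Finset.prod_congr rfl fun b _ => ?_
    by_cases hb : b = a
    · subst hb; rw [ha, ha]
    · simp [flipEntry, hb]
  simp only [h2, hF, mul_neg, Finset.sum_neg_distrib] at h1
  change colE D F = -colE D F at h1
  linarith

/-- Only the Fourier mass avoiding the uniform columns `K` correlates with the other rows. -/
lemma abs_colE_row_mul_le (hD : ∀ a, UniformMarginals (D a)) {K : Finset N}
    (hK : ∀ a ∈ K, ∀ z, D a z = 1 / 2 ^ k) (j : Fin k) (H : (N → Bool) → ℝ)
    {F : (N → Fin k → Bool) → ℝ} (hF : ∀ a Z, F (flipEntry a j Z) = F Z) (hF1 : ∀ Z, |F Z| ≤ 1)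
    {τ : ℝ} (hτ : 0 < τ) :
    |colE D (fun Z => H (row Z j) * F Z)|
      ≤ (τ + (∑ β ∈ univ.filter (fun β => Disjoint β K), walshCoeff H β ^ 2) / τ) / 2 := by
  set S : Finset (Finset N) := univ.filter (fun β => Disjoint β K) with hS
  set H' : (N → Bool) → ℝ := fun x => ∑ β ∈ S, walshCoeff H β * walsh β x with hH'
  have hzero : ∀ β, β ∉ S → colE D (fun Z => walsh β (row Z j) * F Z) = 0 := by
    intro β hβ
    obtain ⟨a, haβ, haK⟩ := Finset.not_disjoint_iff.mp (by simpa [hS] using hβ)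
    refine colE_eq_zero_of_flipEntry (hK a haK) j fun Z => ?_
    rw [row_flipEntry_self, walsh_flipBit, hF, if_pos haβ]
    ring
  have h1 : colE D (fun Z => H (row Z j) * F Z) = colE D (fun Z => H' (row Z j) * F Z) := by
    have e1 : (fun Z : N → Fin k → Bool => H (row Z j) * F Z)
        = fun Z => ∑ β, walshCoeff H β * (walsh β (row Z j) * F Z) := by
      funext Z
      conv_lhs => rw [walsh_inversion H (row Z j), Finset.sum_mul]
      simp only [mul_assoc]
    have e2 : (fun Z : N → Fin k → Bool => H' (row Z j) * F Z)
        = fun Z => ∑ β ∈ S, walshCoeff H β * (walsh β (row Z j) * F Z) := by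
      funext Z
      simp only [hH', Finset.sum_mul, mul_assoc]
    rw [e1, e2, colE_sum, colE_sum]
    symm
    refine Finset.sum_subset (Finset.subset_univ S) fun β _ hβ => ?_
    rw [colE_const_mul, hzero β hβ, mul_zero]
  rw [h1]
  calc |colE D (fun Z => H' (row Z j) * F Z)|
      ≤ colE D (fun Z => |H' (row Z j) * F Z|) := abs_colE_le hD _
    _ ≤ colE D (fun Z => (fun x => (τ + H' x ^ 2 / τ) / 2) (row Z j)) := by
        refine colE_mono hD fun Z => ?_
        rw [abs_mul]
        have ha : |H' (row Z j)| * |F Z| ≤ |H' (row Z j)| :=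
          mul_le_of_le_one_right (abs_nonneg _) (hF1 Z)
        refine ha.trans ?_
        have hsq : |H' (row Z j)| ^ 2 = H' (row Z j) ^ 2 := sq_abs _
        have : τ + H' (row Z j) ^ 2 / τ = (τ ^ 2 + |H' (row Z j)| ^ 2) / τ := by
          rw [hsq]; field_simp
        simp only []
        rw [this, le_div_iff₀ two_pos, le_div_iff₀ hτ]
        nlinarith [sq_nonneg (τ - |H' (row Z j)|)]
    _ = (τ + (∑ β ∈ S, walshCoeff H β ^ 2) / τ) / 2 := by
        rw [colE_row hD j (fun x => (τ + H' x ^ 2 / τ) / 2), ← cubeMean_sq_walsh_sum]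
        simp only [cubeMean]
        have hc : (0 : ℝ) < 2 ^ Fintype.card N := by positivity
        rw [← Finset.sum_div, Finset.sum_add_distrib, ← Finset.sum_div]
        simp only [Finset.sum_const, Finset.card_univ, nsmul_eq_mul, Fintype.card_fun,
          Fintype.card_bool]
        push_cast
        field_simp
        rfl

lemma abs_prod_le_one {ι : Type} (s : Finset ι) {f : ι → ℝ} (h : ∀ i ∈ s, |f i| ≤ 1) :
    |∏ i ∈ s, f i| ≤ 1 := by
  rw [Finset.abs_prod]
  exact Finset.prod_le_one (fun i _ => abs_nonneg _) h

/-- Replacing `g` by `g'` in every row costs at most the Fourier mass of `g - g'` avoiding the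
uniform columns. -/
lemma abs_colE_prod_sub_le (hD : ∀ a, UniformMarginals (D a)) {K : Finset N}
    (hK : ∀ a ∈ K, ∀ z, D a z = 1 / 2 ^ k) {g g' : (N → Bool) → ℝ} (hg : ∀ x, |g x| ≤ 1)
    (hg' : ∀ x, |g' x| ≤ 1) {τ : ℝ} (hτ : 0 < τ) :
    |colE D (fun Z => ∏ j, g (row Z j)) - colE D (fun Z => ∏ j, g' (row Z j))|
      ≤ k * ((τ + (∑ β ∈ univ.filter (fun β => Disjoint β K),
          walshCoeff (fun x => g x - g' x) β ^ 2) / τ) / 2) := by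
  set η := (τ + (∑ β ∈ univ.filter (fun β => Disjoint β K),
          walshCoeff (fun x => g x - g' x) β ^ 2) / τ) / 2
  have key : ∀ s : Finset (Fin k),
      |colE D (fun Z => ∏ j, if j ∈ s then g (row Z j) else g' (row Z j))
        - colE D (fun Z => ∏ j, g' (row Z j))| ≤ s.card * η := by
    intro s
    induction s using Finset.induction_on with
    | empty => simp
    | insert i s hi ih =>
      have e : colE D (fun Z => ∏ j, if j ∈ insert i s then g (row Z j) else g' (row Z j))
          - colE D (fun Z => ∏ j, if j ∈ s then g (row Z j) else g' (row Z j))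
          = colE D (fun Z => (fun x => g x - g' x) (row Z i) *
              ∏ j ∈ univ.erase i, if j ∈ s then g (row Z j) else g' (row Z j)) := by
        rw [← colE_sub]
        congr 1
        funext Z
        rw [← Finset.mul_prod_erase univ _ (mem_univ i),
          ← Finset.mul_prod_erase univ (fun j => if j ∈ s then g (row Z j) else g' (row Z j))
            (mem_univ i), sub_mul]
        simp only [Finset.mem_insert_self, if_true, if_neg hi]
        congr 2
        refine Finset.prod_congr rfl fun j hj => ?_
        simp [Finset.ne_of_mem_erase hj]
      have hb := abs_colE_row_mul_le hD hK i (fun x => g x - g' x)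
        (F := fun Z => ∏ j ∈ univ.erase i, if j ∈ s then g (row Z j) else g' (row Z j))
        (fun a Z => Finset.prod_congr rfl fun j hj => by
          rw [row_flipEntry_of_ne a (Finset.ne_of_mem_erase hj)])
        (fun Z => abs_prod_le_one _ fun j _ => by split_ifs; exacts [hg _, hg' _]) hτ
      rw [← e] at hb
      change _ ≤ η at hb
      rw [Finset.card_insert_of_notMem hi]
      push_cast
      have := abs_sub_le
        (colE D (fun Z => ∏ j, if j ∈ insert i s then g (row Z j) else g' (row Z j)))
        (colE D (fun Z => ∏ j, if j ∈ s then g (row Z j) else g' (row Z j)))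
        (colE D (fun Z => ∏ j, g' (row Z j)))
      linarith
  simpa using key univ

lemma sum_eq_zero_of_sum_update_eq_zero (a : N) {Φ : (N → Fin k → Bool) → ℝ}
    (h : ∀ Z, ∑ z, Φ (Function.update Z a z) = 0) : ∑ Z, Φ Z = 0 := by
  let e : (N → Fin k → Bool) × (Fin k → Bool) → (N → Fin k → Bool) × (Fin k → Bool) :=
    fun p => (Function.update p.1 a p.2, p.1 a)
  have he : Function.Involutive e := by
    intro p
    simp [e]
  have h1 : ∑ p : (N → Fin k → Bool) × (Fin k → Bool), Φ (e p).1
      = ∑ p : (N → Fin k → Bool) × (Fin k → Bool), Φ p.1 :=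
    Equiv.sum_comp he.toPerm (fun p : (N → Fin k → Bool) × (Fin k → Bool) => Φ p.1)
  rw [Fintype.sum_prod_type, Fintype.sum_prod_type] at h1
  simp only [e, h, Finset.sum_const_zero, Finset.sum_const, nsmul_eq_mul, ← Finset.mul_sum] at h1
  have hc : ((univ : Finset (Fin k → Bool)).card : ℝ) ≠ 0 := by simp
  exact (mul_eq_zero.mp h1.symm).resolve_left hc

lemma row_update (a : N) (j : Fin k) (Z : N → Fin k → Bool) (z : Fin k → Bool) :
    row (Function.update Z a z) j = Function.update (row Z j) a (z j) := by
  funext b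
  by_cases hb : b = a
  · subst hb; simp [row]
  · simp [row, hb]

lemma evenPart_add_oddPart (a : N) (f : (N → Bool) → ℝ) (x : N → Bool) :
    oddPart a f x + evenPart a f x = f x := by
  unfold evenPart oddPart; ring

lemma update_eq_or_flipBit (a : N) (x : N → Bool) (b : Bool) :
    (b = x a ∧ Function.update x a b = x) ∨ (b = !x a ∧ Function.update x a b = flipBit a x) := by
  by_cases h : b = x a
  · left; subst h; simp
  · right
    have : b = !x a := by cases b <;> cases hx : x a <;> simp_all
    subst this
    exact ⟨rfl, rfl⟩

lemma evenPart_update (a : N) (f : (N → Bool) → ℝ) (x : N → Bool) (b : Bool) :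
    evenPart a f (Function.update x a b) = evenPart a f x := by
  rcases update_eq_or_flipBit a x b with ⟨_, h⟩ | ⟨_, h⟩
  · rw [h]
  · rw [h, evenPart, flipBit_flipBit, evenPart, add_comm]

lemma oddPart_update (a : N) (f : (N → Bool) → ℝ) (x : N → Bool) (b : Bool) :
    oddPart a f (Function.update x a b) = bitSign b * (bitSign (x a) * oddPart a f x) := by
  rcases update_eq_or_flipBit a x b with ⟨hb, h⟩ | ⟨hb, h⟩
  · rw [h, hb, ← mul_assoc, bitSign_mul_self, one_mul]
  · rw [h, hb, ← mul_assoc, bitSign_not, neg_mul, bitSign_mul_self, oddPart, flipBit_flipBit,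
      oddPart]
    ring

lemma abs_evenPart_le (a : N) {f : (N → Bool) → ℝ} (hf : ∀ x, |f x| ≤ 1) (x : N → Bool) :
    |evenPart a f x| ≤ 1 := by
  have h1 := abs_le.mp (hf x)
  have h2 := abs_le.mp (hf (flipBit a x))
  unfold evenPart
  exact abs_le.mpr ⟨by linarith, by linarith⟩

lemma abs_oddPart_le (a : N) {f : (N → Bool) → ℝ} (hf : ∀ x, |f x| ≤ 1) (x : N → Bool) :
    |oddPart a f x| ≤ 1 := by
  have h1 := abs_le.mp (hf x)
  have h2 := abs_le.mp (hf (flipBit a x))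
  unfold oddPart
  exact abs_le.mpr ⟨by linarith, by linarith⟩

lemma abs_prod_le_sum_sq {ι : Type} [Fintype ι] [DecidableEq ι] {T : Finset ι} (hT : 1 < T.card)
    {f : ι → ℝ} (hf : ∀ i, |f i| ≤ 1) : |∏ i ∈ T, f i| ≤ ∑ i, f i ^ 2 := by
  obtain ⟨i, hi, j, hj, hij⟩ := Finset.one_lt_card.mp hT
  have hj' : j ∈ T.erase i := Finset.mem_erase.mpr ⟨hij.symm, hj⟩
  rw [← Finset.mul_prod_erase T f hi, ← Finset.mul_prod_erase (T.erase i) f hj', ← mul_assoc,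
    abs_mul, abs_mul]
  have h1 : |∏ x ∈ (T.erase i).erase j, f x| ≤ 1 := abs_prod_le_one _ fun x _ => hf x
  have h2 : f i ^ 2 + f j ^ 2 ≤ ∑ x, f x ^ 2 := by
    rw [← Finset.sum_pair (f := fun x => f x ^ 2) hij]
    exact Finset.sum_le_sum_of_subset_of_nonneg (Finset.subset_univ _) fun x _ _ => sq_nonneg _
  have h3 : |f i| * |f j| ≤ f i ^ 2 + f j ^ 2 := by
    rw [← sq_abs (f i), ← sq_abs (f j)]
    nlinarith [sq_nonneg (|f i| - |f j|), sq_nonneg (|f i|), sq_nonneg (|f j|)]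
  calc |f i| * |f j| * |∏ x ∈ (T.erase i).erase j, f x| ≤ |f i| * |f j| :=
        mul_le_of_le_one_right (by positivity) h1
    _ ≤ _ := h3.trans h2

/-- The term of the expansion of `∏ j, g (row Z j)` that is odd in column `a` exactly in the
rows of `T`. -/
noncomputable def parityTerm (a : N) (g : (N → Bool) → ℝ) (T : Finset (Fin k))
    (Z : N → Fin k → Bool) : ℝ :=
  (∏ j ∈ T, oddPart a g (row Z j)) * ∏ j ∈ univ \ T, evenPart a g (row Z j)

lemma prod_row_eq_sum_parityTerm (a : N) (g : (N → Bool) → ℝ) (Z : N → Fin k → Bool) :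
    ∏ j, g (row Z j) = ∑ T : Finset (Fin k), parityTerm a g T Z := by
  simp only [parityTerm]
  rw [← Finset.powerset_univ, ← Finset.prod_add]
  simp only [evenPart_add_oddPart]

/-- Terms odd in at most one row do not see the law of a column with uniform marginals. -/
lemma colE_parityTerm_eq (hD : ∀ a, UniformMarginals (D a)) (hD' : ∀ a, UniformMarginals (D' a))
    {a : N} (h : ∀ b, b ≠ a → D b = D' b) (g : (N → Bool) → ℝ) {T : Finset (Fin k)}
    (hT : T.card ≤ 1) : colE D (parityTerm a g T) = colE D' (parityTerm a g T) := by
  rw [← sub_eq_zero, colE, colE, ← Finset.sum_sub_distrib]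
  refine sum_eq_zero_of_sum_update_eq_zero a fun Z => ?_
  set G : ℝ := (∏ j ∈ T, bitSign (row Z j a) * oddPart a g (row Z j)) *
    ∏ j ∈ univ \ T, evenPart a g (row Z j)
  have hprod : ∀ (E : N → (Fin k → Bool) → ℝ) (z : Fin k → Bool),
      ∏ b, E b (Function.update Z a z b) = E a z * ∏ b ∈ univ.erase a, E b (Z b) := by
    intro E z
    rw [← Finset.mul_prod_erase univ _ (mem_univ a), Function.update_self]
    congr 1
    refine Finset.prod_congr rfl fun b hb => ?_
    rw [Function.update_of_ne (Finset.ne_of_mem_erase hb)]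
  have hoff : ∏ b ∈ univ.erase a, D' b (Z b) = ∏ b ∈ univ.erase a, D b (Z b) :=
    Finset.prod_congr rfl fun b hb => by rw [h b (Finset.ne_of_mem_erase hb)]
  have hterm : ∀ z, parityTerm a g T (Function.update Z a z) = (∏ j ∈ T, bitSign (z j)) * G := by
    intro z
    simp only [parityTerm, row_update, evenPart_update, oddPart_update, G,
      Finset.prod_mul_distrib, mul_assoc]
  have hsign : ∀ {P : (Fin k → Bool) → ℝ}, UniformMarginals P →
      ∑ z, P z * ∏ j ∈ T, bitSign (z j) = if T = ∅ then 1 else 0 := by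
    intro P hP
    rcases Nat.le_one_iff_eq_zero_or_eq_one.mp hT with h0 | h1
    · rw [Finset.card_eq_zero] at h0
      subst h0; simp [hP.sum_eq_one]
    · obtain ⟨j, rfl⟩ := Finset.card_eq_one.mp h1
      simp [hP.sum_mul_bitSign]
  simp only [hprod, hoff, hterm]
  have e : ∀ z, D a z * (∏ b ∈ univ.erase a, D b (Z b)) * ((∏ j ∈ T, bitSign (z j)) * G)
      - D' a z * (∏ b ∈ univ.erase a, D b (Z b)) * ((∏ j ∈ T, bitSign (z j)) * G)
      = (D a z * ∏ j ∈ T, bitSign (z j)) * ((∏ b ∈ univ.erase a, D b (Z b)) * G)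
      - (D' a z * ∏ j ∈ T, bitSign (z j)) * ((∏ b ∈ univ.erase a, D b (Z b)) * G) := by
    intro z; ring
  simp only [e, Finset.sum_sub_distrib, ← Finset.sum_mul, hsign (hD a), hsign (hD' a), sub_self]

lemma abs_colE_parityTerm_le (hD : ∀ a, UniformMarginals (D a)) (a : N) {g : (N → Bool) → ℝ}
    (hg : ∀ x, |g x| ≤ 1) {T : Finset (Fin k)} (hT : 1 < T.card) :
    |colE D (parityTerm a g T)| ≤ k * influence a g := by
  calc |colE D (parityTerm a g T)| ≤ colE D (fun Z => |parityTerm a g T Z|) := abs_colE_le hD _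
    _ ≤ colE D (fun Z => ∑ j, (fun x => oddPart a g x ^ 2) (row Z j)) := by
        refine colE_mono hD fun Z => ?_
        rw [parityTerm, abs_mul]
        have h1 := abs_prod_le_sum_sq hT (f := fun j => oddPart a g (row Z j))
          fun j => abs_oddPart_le a hg _
        have h2 : |∏ j ∈ univ \ T, evenPart a g (row Z j)| ≤ 1 :=
          abs_prod_le_one _ fun j _ => abs_evenPart_le a hg _
        exact (mul_le_of_le_one_right (abs_nonneg _) h2).trans h1
    _ = k * influence a g := by
        rw [colE_sum, Finset.sum_congr rfl fun j _ => colE_row hD j (fun x => oddPart a g x ^ 2)]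
        simp [influence]

lemma abs_colE_sub_le_of_column (hD : ∀ a, UniformMarginals (D a))
    (hD' : ∀ a, UniformMarginals (D' a)) {a : N} (h : ∀ b, b ≠ a → D b = D' b)
    {g : (N → Bool) → ℝ} (hg : ∀ x, |g x| ≤ 1) :
    |colE D (fun Z => ∏ j, g (row Z j)) - colE D' (fun Z => ∏ j, g (row Z j))|
      ≤ 2 ^ k * (2 * k) * influence a g := by
  simp only [prod_row_eq_sum_parityTerm a g]
  rw [colE_sum, colE_sum, ← Finset.sum_sub_distrib]
  refine (Finset.abs_sum_le_sum_abs _ _).trans ?_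
  have hterm : ∀ T : Finset (Fin k),
      |colE D (parityTerm a g T) - colE D' (parityTerm a g T)| ≤ 2 * (k * influence a g) := by
    intro T
    have hpos : 0 ≤ k * influence a g := mul_nonneg (Nat.cast_nonneg k) (influence_nonneg a g)
    by_cases hT : T.card ≤ 1
    · rw [colE_parityTerm_eq hD hD' h g hT, sub_self, abs_zero]
      linarith
    · have h1 := abs_colE_parityTerm_le hD a hg (not_le.mp hT)
      have h2 := abs_colE_parityTerm_le hD' a hg (not_le.mp hT)
      have h3 := abs_sub (colE D (parityTerm a g T)) (colE D' (parityTerm a g T))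
      linarith
  refine (Finset.sum_le_sum fun T _ => hterm T).trans (le_of_eq ?_)
  simp [Finset.card_univ]
  ring

/-- Changing the laws of the columns in `B` (keeping the marginals uniform) changes the
correlation of the rows by at most the total influence of `B`. -/
lemma abs_colE_sub_le_of_columns (hD : ∀ a, UniformMarginals (D a))
    (hD' : ∀ a, UniformMarginals (D' a)) {B : Finset N} (h : ∀ b, b ∉ B → D' b = D b)
    {g : (N → Bool) → ℝ} (hg : ∀ x, |g x| ≤ 1) :
    |colE D' (fun Z => ∏ j, g (row Z j)) - colE D (fun Z => ∏ j, g (row Z j))|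
      ≤ 2 ^ k * (2 * k) * ∑ a ∈ B, influence a g := by
  have key : ∀ s : Finset N,
      |colE (fun b => if b ∈ s then D' b else D b) (fun Z => ∏ j, g (row Z j))
        - colE D (fun Z => ∏ j, g (row Z j))| ≤ 2 ^ k * (2 * k) * ∑ a ∈ s, influence a g := by
    intro s
    induction s using Finset.induction_on with
    | empty => simp
    | insert i s hi ih =>
      have hm : ∀ (t : Finset N) (b : N), UniformMarginals (if b ∈ t then D' b else D b) := by
        intro t b; split_ifs; exacts [hD' b, hD b]
      have h1 := abs_colE_sub_le_of_column (a := i) (hm (insert i s)) (hm s)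
        (fun b hb => by simp [hb]) hg
      rw [Finset.sum_insert hi, mul_add]
      exact (abs_sub_le _ _ _).trans (add_le_add h1 ih)
  have e : (fun b => if b ∈ B then D' b else D b) = D' := by
    funext b
    split_ifs with hb
    exacts [rfl, (h b hb).symm]
  simpa only [e] using key B

end Columns

section Covariance

/-- Correlation of two functions of independent uniform bits, bounded by the products of their
coordinatewise oscillations. -/
lemma abs_covariance_le {n : ℕ} (f g : (Fin n → Bool) → ℝ) (p q : Fin n → ℝ)
    (hf : ∀ i c, |f (Function.update c i true) - f (Function.update c i false)| ≤ p i)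
    (hg : ∀ i c, |g (Function.update c i true) - g (Function.update c i false)| ≤ q i) :
    |(∑ c, f c * g c) / 2 ^ n - ((∑ c, f c) / 2 ^ n) * ((∑ c, g c) / 2 ^ n)|
      ≤ ∑ i, p i * q i := by
  induction n with
  | zero => simp
  | succ n ih =>
    have split : ∀ F : (Fin (n + 1) → Bool) → ℝ, ∑ c, F c
        = ∑ c : Fin n → Bool, F (Fin.cons true c) + ∑ c : Fin n → Bool, F (Fin.cons false c) := by
      intro F
      rw [← (Fin.consEquiv fun _ => Bool).sum_comp, Fintype.sum_prod_type, Fintype.sum_bool]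
      rfl
    have hstep : ∀ b, |(∑ c : Fin n → Bool, f (Fin.cons b c) * g (Fin.cons b c)) / 2 ^ n
        - ((∑ c : Fin n → Bool, f (Fin.cons b c)) / 2 ^ n) *
          ((∑ c : Fin n → Bool, g (Fin.cons b c)) / 2 ^ n)| ≤ ∑ i : Fin n, p i.succ * q i.succ := by
      intro b
      refine ih (fun c => f (Fin.cons b c)) (fun c => g (Fin.cons b c)) (fun i => p i.succ)
        (fun i => q i.succ) ?_ ?_
      · intro i c
        have := hf i.succ (Fin.cons b c)
        rwa [← Fin.cons_update, ← Fin.cons_update] at this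
      · intro i c
        have := hg i.succ (Fin.cons b c)
        rwa [← Fin.cons_update, ← Fin.cons_update] at this
    have hosc : ∀ (F : (Fin (n + 1) → Bool) → ℝ) (r : ℝ),
        (∀ c, |F (Function.update c 0 true) - F (Function.update c 0 false)| ≤ r) →
        |(∑ c : Fin n → Bool, F (Fin.cons true c)) / 2 ^ n
          - (∑ c : Fin n → Bool, F (Fin.cons false c)) / 2 ^ n| ≤ r := by
      intro F r hF
      rw [← sub_div, ← Finset.sum_sub_distrib, abs_div, abs_of_pos (by positivity : (0 : ℝ) < 2 ^ n),
        div_le_iff₀ (by positivity)]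
      refine (Finset.abs_sum_le_sum_abs _ _).trans ?_
      refine (Finset.sum_le_sum (g := fun _ => r) fun c _ => ?_).trans (le_of_eq ?_)
      · have := hF (Fin.cons true c)
        rwa [Fin.update_cons_zero, Fin.update_cons_zero] at this
      · simp [Finset.card_univ, mul_comm]
    rw [Fin.sum_univ_succ, split, split f, split g]
    have h1 := hstep true
    have h2 := hstep false
    have h3 := hosc f (p 0) (hf 0)
    have h4 := hosc g (q 0) (hg 0)
    set S1 := ∑ c : Fin n → Bool, f (Fin.cons true c) * g (Fin.cons true c)
    set S2 := ∑ c : Fin n → Bool, f (Fin.cons false c) * g (Fin.cons false c)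
    set A1 := ∑ c : Fin n → Bool, f (Fin.cons true c)
    set A2 := ∑ c : Fin n → Bool, f (Fin.cons false c)
    set B1 := ∑ c : Fin n → Bool, g (Fin.cons true c)
    set B2 := ∑ c : Fin n → Bool, g (Fin.cons false c)
    set M : ℝ := 2 ^ n with hM
    have hMpos : 0 < M := by positivity
    have hpow : (2 : ℝ) ^ (n + 1) = M * 2 := pow_succ _ _
    rw [hpow]
    have e : (S1 + S2) / (M * 2) - (A1 + A2) / (M * 2) * ((B1 + B2) / (M * 2))
        = (S1 / M - A1 / M * (B1 / M)) / 2 + (S2 / M - A2 / M * (B2 / M)) / 2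
          + (A1 / M - A2 / M) * (B1 / M - B2 / M) / 4 := by
      field_simp
      ring
    rw [e]
    have h5 : |(A1 / M - A2 / M) * (B1 / M - B2 / M)| ≤ p 0 * q 0 := by
      rw [abs_mul]
      exact mul_le_mul h3 h4 (abs_nonneg _) ((abs_nonneg _).trans h3)
    have h6 := abs_le.mp h1
    have h7 := abs_le.mp h2
    have h8 := abs_le.mp h5
    have h9 : 0 ≤ p 0 * q 0 := (abs_nonneg _).trans h5
    exact abs_le.mpr ⟨by linarith, by linarith⟩

end Covariance

section Test

variable {U V : Type} {k L R : ℕ}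

/-- The position in `[R]` of a coordinate of the doubled cube. -/
def basePos : Fin R ⊕ Fin R → Fin R := Sum.elim id id

/-- The half of the doubled cube a coordinate lies in. -/
def half : Fin R ⊕ Fin R → Bool := Sum.elim (fun _ => false) (fun _ => true)

/-- The law of column `a` given the bits `c` and the resampling pattern `r`, where `r i = some h`
says that half `h` of block `i` is resampled. -/
noncomputable def colLaw (P0 P1 : (Fin k → Bool) → ℝ) (ρ : Fin R → Fin L) (c : Fin L → Bool)
    (r : Fin L → Option Bool) (a : Fin R ⊕ Fin R) : (Fin k → Bool) → ℝ :=
  if r (ρ (basePos a)) = some (half a) then fun _ => 1 / 2 ^ k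
  else pick P0 P1 (c (ρ (basePos a)))

/-- The probability of a resampling choice in one block. -/
noncomputable def resampleProb (ε : ℝ) : Option Bool → ℝ
  | none => 1 - 2 * ε
  | some _ => ε

/-- The probability of a resampling pattern. -/
noncomputable def patternProb (ε : ℝ) (r : Fin L → Option Bool) : ℝ :=
  ∏ i, resampleProb ε (r i)

lemma prod_fib_colLaw (P0 P1 : (Fin k → Bool) → ℝ) (ρ : Fin R → Fin L) (c : Fin L → Bool)
    (r : Fin L → Option Bool) (Z : Fin R ⊕ Fin R → Fin k → Bool) :
    ∏ i, ∏ j ∈ univ.filter (fun j => ρ j = i),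
      ((if r i = some false then fun _ => 1 / 2 ^ k else pick P0 P1 (c i)) (Z (Sum.inl j)) *
       (if r i = some true then fun _ => 1 / 2 ^ k else pick P0 P1 (c i)) (Z (Sum.inr j)))
      = ∏ a, colLaw P0 P1 ρ c r a (Z a) := by
  rw [Fintype.prod_sum_type, ← Finset.prod_mul_distrib, ← Finset.prod_fiberwise univ ρ]
  refine Finset.prod_congr rfl fun i _ => Finset.prod_congr rfl fun j hj => ?_
  have hj' : ρ j = i := (Finset.mem_filter.mp hj).2
  subst hj'
  by_cases h1 : r (ρ j) = some false <;> by_cases h2 : r (ρ j) = some true <;>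
    simp [colLaw, basePos, half, h1, h2]

lemma blockM_eq (π : U → V → Fin R → Fin L) (ε : ℝ) (P0 P1 : (Fin k → Bool) → ℝ) (d : ℕ)
    (u : U) (v w : V) (i : Fin L) (hv : (fib π u v i).card = d) (hw : (fib π u w i).card = d)
    (X Y : Fin k → (Fin R ⊕ Fin R) → Bool) :
    blockM π ε P0 P1 d u v w i X Y = ∑ o : Option Bool, ∑ b : Bool, (1 / 2) * resampleProb ε o *
      ((∏ j ∈ fib π u v i,
        ((if o = some false then fun _ => 1 / 2 ^ k else pick P0 P1 b) (fun r => X r (Sum.inl j)) *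
         (if o = some true then fun _ => 1 / 2 ^ k else pick P0 P1 b) (fun r => X r (Sum.inr j)))) *
       (∏ j ∈ fib π u w i,
        ((if o = some false then fun _ => 1 / 2 ^ k else pick P0 P1 (!b))
            (fun r => Y r (Sum.inl j)) *
         (if o = some true then fun _ => 1 / 2 ^ k else pick P0 P1 (!b))
            (fun r => Y r (Sum.inr j))))) := by
  rw [blockM, Finset.sum_comm, Finset.mul_sum]
  refine Finset.sum_congr rfl fun b _ => ?_
  rw [Fintype.sum_option, Fintype.sum_bool]
  simp [resampleProb, Finset.prod_mul_distrib, hv, hw]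
  ring

lemma massT2_eq (π : U → V → Fin R → Fin L) (ε : ℝ) (P0 P1 : (Fin k → Bool) → ℝ) (d : ℕ)
    (u : U) (v w : V) (hfib : ∀ u v i, (fib π u v i).card = d)
    (X Y : Fin k → (Fin R ⊕ Fin R) → Bool) :
    massT2 π ε P0 P1 d u v w X Y = ∑ r : Fin L → Option Bool, patternProb ε r *
      ((∑ c : Fin L → Bool, (∏ a, colLaw P0 P1 (π u v) c r a (fun j => X j a)) *
        ∏ a, colLaw P0 P1 (π u w) (fun i => !c i) r a (fun j => Y j a)) / 2 ^ L) := by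
  rw [massT2, Finset.prod_congr rfl fun i _ =>
    blockM_eq π ε P0 P1 d u v w i (hfib u v i) (hfib u w i) X Y,
    Finset.prod_univ_sum, Fintype.piFinset_univ]
  refine Finset.sum_congr rfl fun r _ => ?_
  rw [Finset.prod_univ_sum, Fintype.piFinset_univ, Finset.sum_div, Finset.mul_sum]
  refine Finset.sum_congr rfl fun c _ => ?_
  rw [← prod_fib_colLaw, ← prod_fib_colLaw, Finset.prod_mul_distrib, Finset.prod_mul_distrib,
    Finset.prod_mul_distrib]
  simp only [Finset.prod_const, Finset.card_univ, Fintype.card_fin, patternProb, fib]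
  rw [one_div, inv_pow]
  ring

/-- The conditional expectation of `∏ j, g (x_j)` given the bits `c` and the resampling
pattern `r`. -/
noncomputable def condProd (P0 P1 : (Fin k → Bool) → ℝ) (ρ : Fin R → Fin L)
    (g : ((Fin R ⊕ Fin R) → Bool) → ℝ) (c : Fin L → Bool) (r : Fin L → Option Bool) : ℝ :=
  colE (colLaw P0 P1 ρ c r) (fun Z => ∏ j, g (row Z j))

lemma condProd_eq_sum (P0 P1 : (Fin k → Bool) → ℝ) (ρ : Fin R → Fin L)
    (g : ((Fin R ⊕ Fin R) → Bool) → ℝ) (c : Fin L → Bool) (r : Fin L → Option Bool) :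
    condProd P0 P1 ρ g c r = ∑ X : Fin k → (Fin R ⊕ Fin R) → Bool,
      (∏ a, colLaw P0 P1 ρ c r a (fun j => X j a)) * ∏ j, g (X j) :=
  ((Equiv.piComm fun (_ : Fin k) (_ : Fin R ⊕ Fin R) => Bool).sum_comp
    (fun Z => (∏ a, colLaw P0 P1 ρ c r a (Z a)) * ∏ j, g (row Z j))).symm

lemma ET2_eq (π : U → V → Fin R → Fin L) (ε : ℝ) (P0 P1 : (Fin k → Bool) → ℝ) (d : ℕ)
    (u : U) (v w : V) (hfib : ∀ u v i, (fib π u v i).card = d)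
    (g : V → ((Fin R ⊕ Fin R) → Bool) → ℝ) :
    ET2 π ε P0 P1 d u v w (fun X Y => ∏ j : Fin k, g v (X j) * g w (Y j))
      = ∑ r : Fin L → Option Bool, patternProb ε r *
        ((∑ c : Fin L → Bool, condProd P0 P1 (π u v) (g v) c r *
          condProd P0 P1 (π u w) (g w) (fun i => !c i) r) / 2 ^ L) := by
  simp only [ET2, massT2_eq π ε P0 P1 d u v w hfib, condProd_eq_sum, Finset.sum_mul_sum]
  simp only [Finset.sum_mul, Finset.mul_sum, Finset.sum_div]
  rw [Finset.sum_congr rfl fun X _ => Finset.sum_comm]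
  rw [Finset.sum_comm]
  refine Finset.sum_congr rfl fun r _ => ?_
  rw [Finset.sum_congr rfl fun X _ => Finset.sum_comm]
  rw [Finset.sum_comm]
  refine Finset.sum_congr rfl fun c _ => Finset.sum_congr rfl fun X _ =>
    Finset.sum_congr rfl fun Y _ => ?_
  rw [Finset.prod_mul_distrib]
  ring

lemma colLaw_uniformMarginals {P0 P1 : (Fin k → Bool) → ℝ} (h0 : UniformMarginals P0)
    (h1 : UniformMarginals P1) (ρ : Fin R → Fin L) (c : Fin L → Bool) (r : Fin L → Option Bool)
    (a : Fin R ⊕ Fin R) : UniformMarginals (colLaw P0 P1 ρ c r a) := by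
  unfold colLaw pick
  split_ifs
  exacts [UniformMarginals.uniform, h1, h0]

lemma patternProb_nonneg {ε : ℝ} (h0 : 0 ≤ ε) (h1 : ε ≤ 1 / 2) (r : Fin L → Option Bool) :
    0 ≤ patternProb ε r := by
  refine Finset.prod_nonneg fun i _ => ?_
  cases r i <;> simp only [resampleProb] <;> linarith

lemma sum_patternProb_mul_prod (ε : ℝ) (φ : Fin L → Option Bool → ℝ) :
    ∑ r : Fin L → Option Bool, patternProb ε r * ∏ i, φ i (r i)
      = ∏ i, ∑ o, resampleProb ε o * φ i o := by
  rw [Finset.prod_univ_sum, Fintype.piFinset_univ]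
  simp only [patternProb, Finset.prod_mul_distrib]

lemma sum_patternProb (ε : ℝ) : ∑ r : Fin L → Option Bool, patternProb ε r = 1 := by
  have := sum_patternProb_mul_prod (L := L) ε (fun _ _ => 1)
  simp only [Finset.prod_const_one, mul_one] at this
  rw [this]
  refine Finset.prod_eq_one fun i _ => ?_
  simp [Fintype.sum_option, resampleProb]

/-- The coordinates resampled under the pattern `r`. -/
def resampled (ρ : Fin R → Fin L) (r : Fin L → Option Bool) : Finset (Fin R ⊕ Fin R) :=
  univ.filter (fun a => r (ρ (basePos a)) = some (half a))

/-- The blocks met by a set of coordinates. -/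
def blocks (ρ : Fin R → Fin L) (β : Finset (Fin R ⊕ Fin R)) : Finset (Fin L) :=
  (β.image basePos).image ρ

/-- The probability that no coordinate of `β` is resampled decays with the number of blocks. -/
lemma sum_patternProb_disjoint_le {ε : ℝ} (h0 : 0 ≤ ε) (h1 : ε ≤ 1 / 2) (ρ : Fin R → Fin L)
    (β : Finset (Fin R ⊕ Fin R)) :
    ∑ r : Fin L → Option Bool, patternProb ε r * (if Disjoint β (resampled ρ r) then 1 else 0)
      ≤ (1 - ε) ^ (blocks ρ β).card := by
  have hex : ∀ i, ∃ h : Bool, i ∈ blocks ρ β → ∃ a ∈ β, ρ (basePos a) = i ∧ half a = h := by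
    intro i
    by_cases hi : i ∈ blocks ρ β
    · simp only [blocks, Finset.mem_image] at hi
      obtain ⟨_, ⟨a, ha, rfl⟩, hai⟩ := hi
      exact ⟨half a, fun _ => ⟨a, ha, hai, rfl⟩⟩
    · exact ⟨true, fun h => absurd h hi⟩
  choose h hh using hex
  have hle : ∀ r : Fin L → Option Bool,
      patternProb ε r * (if Disjoint β (resampled ρ r) then (1 : ℝ) else 0)
        ≤ patternProb ε r * ∏ i, if i ∈ blocks ρ β ∧ r i = some (h i) then 0 else 1 := by
    intro r
    refine mul_le_mul_of_nonneg_left ?_ (patternProb_nonneg h0 h1 r)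
    split_ifs with hd
    · refine (Finset.prod_eq_one fun i _ => ?_).ge
      rw [if_neg]
      rintro ⟨hi, hr⟩
      obtain ⟨a, ha, hai, hah⟩ := hh i hi
      refine Finset.disjoint_left.mp hd ha ?_
      simp [resampled, hai, hah, hr]
    · exact Finset.prod_nonneg fun i _ => by split_ifs <;> norm_num
  refine (Finset.sum_le_sum fun r _ => hle r).trans (le_of_eq ?_)
  rw [sum_patternProb_mul_prod ε (fun i o => if i ∈ blocks ρ β ∧ o = some (h i) then 0 else 1),
    ← Finset.prod_const, ← Finset.prod_ite_mem_eq (blocks ρ β)]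
  refine Finset.prod_congr rfl fun i _ => ?_
  by_cases hi : i ∈ blocks ρ β
  · cases h i <;> simp [Fintype.sum_option, resampleProb, hi] <;> ring
  · simp [Fintype.sum_option, resampleProb, hi]

/-- The Fourier mass of `H` surviving the resampling pattern `r`. -/
noncomputable def survivingMass (ρ : Fin R → Fin L) (H : ((Fin R ⊕ Fin R) → Bool) → ℝ)
    (r : Fin L → Option Bool) : ℝ :=
  ∑ β ∈ univ.filter (fun β => Disjoint β (resampled ρ r)), walshCoeff H β ^ 2

lemma sum_survivingMass_le {ε : ℝ} (h0 : 0 ≤ ε) (h1 : ε ≤ 1 / 2) (ρ : Fin R → Fin L)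
    (H : ((Fin R ⊕ Fin R) → Bool) → ℝ) :
    ∑ r : Fin L → Option Bool, patternProb ε r * survivingMass ρ H r
      ≤ ∑ β, walshCoeff H β ^ 2 * (1 - ε) ^ (blocks ρ β).card := by
  have e : ∑ r : Fin L → Option Bool, patternProb ε r * survivingMass ρ H r
      = ∑ β, walshCoeff H β ^ 2 * ∑ r : Fin L → Option Bool, patternProb ε r *
          (if Disjoint β (resampled ρ r) then 1 else 0) := by
    simp only [survivingMass, Finset.sum_filter, Finset.mul_sum]
    rw [Finset.sum_comm]
    refine Finset.sum_congr rfl fun β _ => Finset.sum_congr rfl fun r _ => ?_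
    split_ifs <;> ring
  rw [e]
  exact Finset.sum_le_sum fun β _ =>
    mul_le_mul_of_nonneg_left (sum_patternProb_disjoint_le h0 h1 ρ β) (sq_nonneg _)

/-- The total influence of the coordinates in block `i`. -/
noncomputable def blockInfluence (ρ : Fin R → Fin L) (g : ((Fin R ⊕ Fin R) → Bool) → ℝ)
    (i : Fin L) : ℝ :=
  ∑ a ∈ univ.filter (fun a => ρ (basePos a) = i), influence a g

lemma abs_condProd_le {P0 P1 : (Fin k → Bool) → ℝ} (h0 : UniformMarginals P0)
    (h1 : UniformMarginals P1) (hk : 0 < k) (ρ : Fin R → Fin L)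
    {g : ((Fin R ⊕ Fin R) → Bool) → ℝ} (hg : ∀ x, |g x| ≤ 1) (c : Fin L → Bool)
    (r : Fin L → Option Bool) : |condProd P0 P1 ρ g c r| ≤ 1 := by
  have hD := colLaw_uniformMarginals h0 h1 ρ c r
  refine (abs_colE_le hD _).trans ?_
  rw [← colE_const hD ⟨0, hk⟩ 1]
  exact colE_mono hD fun Z => abs_prod_le_one _ fun j _ => hg _

lemma abs_condProd_sub_le {P0 P1 : (Fin k → Bool) → ℝ} (h0 : UniformMarginals P0)
    (h1 : UniformMarginals P1) (ρ : Fin R → Fin L) {g g' : ((Fin R ⊕ Fin R) → Bool) → ℝ}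
    (hg : ∀ x, |g x| ≤ 1) (hg' : ∀ x, |g' x| ≤ 1) {τ : ℝ} (hτ : 0 < τ) (c : Fin L → Bool)
    (r : Fin L → Option Bool) :
    |condProd P0 P1 ρ g c r - condProd P0 P1 ρ g' c r|
      ≤ k * ((τ + survivingMass ρ (fun x => g x - g' x) r / τ) / 2) := by
  refine abs_colE_prod_sub_le (colLaw_uniformMarginals h0 h1 ρ c r) (K := resampled ρ r) ?_
    hg hg' hτ
  intro a ha z
  have : r (ρ (basePos a)) = some (half a) := (Finset.mem_filter.mp ha).2
  rw [colLaw, if_pos this]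

lemma abs_condProd_update_sub_le {P0 P1 : (Fin k → Bool) → ℝ} (h0 : UniformMarginals P0)
    (h1 : UniformMarginals P1) (ρ : Fin R → Fin L) {g : ((Fin R ⊕ Fin R) → Bool) → ℝ}
    (hg : ∀ x, |g x| ≤ 1) (c : Fin L → Bool) (r : Fin L → Option Bool) (i : Fin L) (b b' : Bool) :
    |condProd P0 P1 ρ g (Function.update c i b) r - condProd P0 P1 ρ g (Function.update c i b') r|
      ≤ 2 ^ k * (2 * k) * blockInfluence ρ g i := by
  refine abs_colE_sub_le_of_columns (colLaw_uniformMarginals h0 h1 ρ _ r)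
    (colLaw_uniformMarginals h0 h1 ρ _ r) ?_ hg
  intro a ha
  have ha' : ρ (basePos a) ≠ i := by simpa using ha
  simp [colLaw, Function.update_of_ne ha']

/-- The conditional expectation of `∏ j, g (x_j)` given the resampling pattern alone. -/
noncomputable def condMean (P0 P1 : (Fin k → Bool) → ℝ) (ρ : Fin R → Fin L)
    (g : ((Fin R ⊕ Fin R) → Bool) → ℝ) (r : Fin L → Option Bool) : ℝ :=
  (∑ c, condProd P0 P1 ρ g c r) / 2 ^ L

lemma sum_comp_not (F : (Fin L → Bool) → ℝ) : ∑ c : Fin L → Bool, F (fun i => !c i) = ∑ c, F c :=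
  Equiv.sum_comp (Function.Involutive.toPerm (fun (c : Fin L → Bool) i => !c i)
    (fun c => by funext i; simp)) F

lemma le_sum_condProd_mul_condProd {P0 P1 : (Fin k → Bool) → ℝ} (h0 : UniformMarginals P0)
    (h1 : UniformMarginals P1) (hk : 0 < k) (ρ ρ' : Fin R → Fin L)
    {f f' g g' : ((Fin R ⊕ Fin R) → Bool) → ℝ} (hf : ∀ x, |f x| ≤ 1) (hf' : ∀ x, |f' x| ≤ 1)
    (hg : ∀ x, |g x| ≤ 1) (hg' : ∀ x, |g' x| ≤ 1) {τ : ℝ} (hτ : 0 < τ)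
    (r : Fin L → Option Bool) :
    condMean P0 P1 ρ f' r * condMean P0 P1 ρ' g' r
      - k * ((τ + survivingMass ρ (fun x => f x - f' x) r / τ) / 2)
      - k * ((τ + survivingMass ρ' (fun x => g x - g' x) r / τ) / 2)
      - (2 ^ k * (2 * k)) ^ 2 * ∑ i, blockInfluence ρ f' i * blockInfluence ρ' g' i
    ≤ (∑ c : Fin L → Bool, condProd P0 P1 ρ f c r * condProd P0 P1 ρ' g (fun i => !c i) r)
        / 2 ^ L := by
  set A := k * ((τ + survivingMass ρ (fun x => f x - f' x) r / τ) / 2)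
  set B := k * ((τ + survivingMass ρ' (fun x => g x - g' x) r / τ) / 2)
  have hcov := abs_covariance_le (fun c => condProd P0 P1 ρ f' c r)
    (fun c => condProd P0 P1 ρ' g' (fun i => !c i) r)
    (fun i => 2 ^ k * (2 * k) * blockInfluence ρ f' i)
    (fun i => 2 ^ k * (2 * k) * blockInfluence ρ' g' i)
    (fun i c => abs_condProd_update_sub_le h0 h1 ρ hf' c r i true false)
    (fun i c => by
      have hupd : ∀ b, (fun j => !Function.update c i b j)
          = Function.update (fun j => !c j) i (!b) := by
        intro b
        funext j
        by_cases hj : j = i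
        · subst hj; simp
        · simp [hj]
      simp only [hupd]
      exact abs_condProd_update_sub_le h0 h1 ρ' hg' (fun j => !c j) r i _ _)
  rw [sum_comp_not (fun c => condProd P0 P1 ρ' g' c r)] at hcov
  have hcov' := (abs_le.mp hcov).1
  have hsum : ∑ i, 2 ^ k * (2 * (k : ℝ)) * blockInfluence ρ f' i *
      (2 ^ k * (2 * k) * blockInfluence ρ' g' i)
      = (2 ^ k * (2 * k)) ^ 2 * ∑ i, blockInfluence ρ f' i * blockInfluence ρ' g' i := by
    rw [Finset.mul_sum]
    exact Finset.sum_congr rfl fun i _ => by ring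
  rw [hsum] at hcov'
  have hpt : ∀ c : Fin L → Bool,
      condProd P0 P1 ρ f' c r * condProd P0 P1 ρ' g' (fun i => !c i) r - (A + B)
        ≤ condProd P0 P1 ρ f c r * condProd P0 P1 ρ' g (fun i => !c i) r := by
    intro c
    have e1 := abs_condProd_sub_le h0 h1 ρ hf hf' hτ c r
    have e2 := abs_condProd_sub_le h0 h1 ρ' hg hg' hτ (fun i => !c i) r
    have e3 := abs_condProd_le h0 h1 hk ρ hf' c r
    have e4 := abs_condProd_le h0 h1 hk ρ' hg (fun i => !c i) r
    set p := condProd P0 P1 ρ f c r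
    set p' := condProd P0 P1 ρ f' c r
    set q := condProd P0 P1 ρ' g (fun i => !c i) r
    set q' := condProd P0 P1 ρ' g' (fun i => !c i) r
    have e5 : |(p - p') * q| ≤ A := by
      rw [abs_mul]
      exact (mul_le_of_le_one_right (abs_nonneg _) e4).trans e1
    have e6 : |p' * (q - q')| ≤ B := by
      rw [abs_mul]
      exact (mul_le_of_le_one_left (abs_nonneg _) e3).trans e2
    have e7 := (abs_le.mp e5).1
    have e8 := (abs_le.mp e6).1
    linarith [show p * q - p' * q' = (p - p') * q + p' * (q - q') by ring]
  have hsumpt := Finset.sum_le_sum fun (c : Fin L → Bool) (_ : c ∈ univ) => hpt c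
  have hdiv := div_le_div_of_nonneg_right hsumpt (by positivity : (0 : ℝ) ≤ 2 ^ L)
  have hconst : (∑ _c : Fin L → Bool, (A + B)) / 2 ^ L = A + B := by
    simp [Finset.card_univ]
    field_simp
  rw [Finset.sum_sub_distrib, sub_div, hconst] at hdiv
  unfold condMean
  linarith

/-- The averaged surviving mass of `H`. -/
noncomputable def meanSurvivingMass (ε : ℝ) (ρ : Fin R → Fin L)
    (H : ((Fin R ⊕ Fin R) → Bool) → ℝ) : ℝ :=
  ∑ r : Fin L → Option Bool, patternProb ε r * survivingMass ρ H r

lemma le_ET2 (π : U → V → Fin R → Fin L) {ε : ℝ} (hε0 : 0 ≤ ε) (hε1 : ε ≤ 1 / 2)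
    {P0 P1 : (Fin k → Bool) → ℝ} (h0 : UniformMarginals P0) (h1 : UniformMarginals P1)
    (hk : 0 < k) (d : ℕ) (u : U) (v w : V) (hfib : ∀ u v i, (fib π u v i).card = d)
    {g g' : V → ((Fin R ⊕ Fin R) → Bool) → ℝ} (hg : ∀ v x, |g v x| ≤ 1)
    (hg' : ∀ v x, |g' v x| ≤ 1) {τ : ℝ} (hτ : 0 < τ) :
    ∑ r : Fin L → Option Bool, patternProb ε r *
        (condMean P0 P1 (π u v) (g' v) r * condMean P0 P1 (π u w) (g' w) r)
      - k * ((τ + meanSurvivingMass ε (π u v) (fun x => g v x - g' v x) / τ) / 2)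
      - k * ((τ + meanSurvivingMass ε (π u w) (fun x => g w x - g' w x) / τ) / 2)
      - (2 ^ k * (2 * k)) ^ 2 *
          ∑ i, blockInfluence (π u v) (g' v) i * blockInfluence (π u w) (g' w) i
    ≤ ET2 π ε P0 P1 d u v w (fun X Y => ∏ j : Fin k, g v (X j) * g w (Y j)) := by
  rw [ET2_eq π ε P0 P1 d u v w hfib g]
  refine le_trans (le_of_eq ?_) (Finset.sum_le_sum fun r _ => mul_le_mul_of_nonneg_left
    (le_sum_condProd_mul_condProd h0 h1 hk (π u v) (π u w) (hg v) (hg' v) (hg w) (hg' w) hτ r)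
    (patternProb_nonneg hε0 hε1 r))
  have hN : ∀ (ρ : Fin R → Fin L) (H : ((Fin R ⊕ Fin R) → Bool) → ℝ),
      ∑ r : Fin L → Option Bool, patternProb ε r * (k * ((τ + survivingMass ρ H r / τ) / 2))
        = k * ((τ + meanSurvivingMass ε ρ H / τ) / 2) := by
    intro ρ H
    have : ∀ r : Fin L → Option Bool,
        patternProb ε r * (k * ((τ + survivingMass ρ H r / τ) / 2))
          = (k * τ / 2) * patternProb ε r + (k / τ / 2) * (patternProb ε r * survivingMass ρ H r) := by
      intro r; ring
    simp only [this, Finset.sum_add_distrib, ← Finset.mul_sum, sum_patternProb]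
    rw [meanSurvivingMass]
    ring
  simp only [mul_sub, Finset.sum_sub_distrib, hN]
  rw [← Finset.sum_mul, sum_patternProb, one_mul]

end Test

section Decoding

variable {U V : Type} [Fintype U] [Fintype V] {k L R : ℕ} {Adj : U → V → Bool} {dU dV : ℕ}

lemma sum_nbr_comm (F : U → V → ℝ) :
    ∑ u, ∑ v ∈ nbr Adj u, F u v
      = ∑ v, ∑ u ∈ univ.filter (fun u : U => Adj u v = true), F u v := by
  simp only [nbr, Finset.sum_filter]
  exact Finset.sum_comm

lemma card_edges (hU : ∀ u : U, (nbr Adj u).card = dU) :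
    ((univ.filter (fun p : U × V => Adj p.1 p.2 = true)).card : ℝ) = Fintype.card U * dU := by
  rw [Finset.card_filter, Fintype.sum_prod_type]
  have : ∀ u, ∑ v, (if Adj u v = true then 1 else 0) = dU := by
    intro u
    rw [← hU u, nbr, Finset.card_filter]
  simp [this]

lemma card_mul_degree (hU : ∀ u : U, (nbr Adj u).card = dU)
    (hV : ∀ v : V, (univ.filter (fun u : U => Adj u v = true)).card = dV) :
    (Fintype.card U : ℝ) * dU = Fintype.card V * dV := by
  have := sum_nbr_comm (Adj := Adj) (fun _ _ => (1 : ℝ))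
  simpa [hU, hV] using this

lemma Euvw_mono {F G : U → V → V → ℝ} (h : ∀ u v w, F u v w ≤ G u v w) :
    Euvw Adj F ≤ Euvw Adj G := by
  unfold Euvw
  gcongr
  exact h _ _ _

lemma Euvw_sub (F G : U → V → V → ℝ) :
    Euvw Adj (fun u v w => F u v w - G u v w) = Euvw Adj F - Euvw Adj G := by
  simp only [Euvw, Finset.sum_sub_distrib, mul_sub]

lemma Euvw_add (F G : U → V → V → ℝ) :
    Euvw Adj (fun u v w => F u v w + G u v w) = Euvw Adj F + Euvw Adj G := by
  simp only [Euvw, Finset.sum_add_distrib, mul_add]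

lemma Euvw_const_mul (a : ℝ) (F : U → V → V → ℝ) :
    Euvw Adj (fun u v w => a * F u v w) = a * Euvw Adj F := by
  simp only [Euvw, ← Finset.mul_sum]
  simp only [mul_left_comm _ a, ← Finset.mul_sum]

lemma Euvw_left (hU : ∀ u : U, (nbr Adj u).card = dU) (hdU : 0 < dU) (M : U → V → ℝ) :
    Euvw Adj (fun u v _ => M u v) = (∑ u, ∑ v ∈ nbr Adj u, M u v) / (Fintype.card U * dU) := by
  have hd : (dU : ℝ) ≠ 0 := by positivity
  simp only [Euvw, Finset.sum_const, hU, nsmul_eq_mul, ← Finset.mul_sum]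
  field_simp

lemma Euvw_right (hU : ∀ u : U, (nbr Adj u).card = dU) (hdU : 0 < dU) (M : U → V → ℝ) :
    Euvw Adj (fun u _ w => M u w) = Euvw Adj (fun u v _ => M u v) := by
  have hd : (dU : ℝ) ≠ 0 := by positivity
  simp only [Euvw, Finset.sum_const, hU, nsmul_eq_mul, ← Finset.mul_sum]

lemma Euvw_const [Nonempty U] (hU : ∀ u : U, (nbr Adj u).card = dU) (hdU : 0 < dU) (a : ℝ) :
    Euvw Adj (fun _ _ _ => a) = a := by
  have hd : (dU : ℝ) ≠ 0 := by positivity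
  have hc : (Fintype.card U : ℝ) ≠ 0 := by simp
  rw [Euvw_left hU hdU (fun _ _ => a)]
  simp only [Finset.sum_const, hU, nsmul_eq_mul, Finset.card_univ]
  field_simp

/-- Averages over a random edge may be computed from the `V` side. -/
lemma Euvw_left_le [Nonempty U] (hU : ∀ u : U, (nbr Adj u).card = dU) (hdU : 0 < dU)
    (hV : ∀ v : V, (univ.filter (fun u : U => Adj u v = true)).card = dV) (hdV : 0 < dV)
    {M : U → V → ℝ} {B : ℝ}
    (h : ∀ v, (1 / (dV : ℝ)) * ∑ u ∈ univ.filter (fun u : U => Adj u v = true), M u v ≤ B) :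
    Euvw Adj (fun u v _ => M u v) ≤ B := by
  have hdU' : (0 : ℝ) < dU := by positivity
  have hdV' : (0 : ℝ) < dV := by positivity
  have hc : (0 : ℝ) < Fintype.card U := by positivity
  rw [Euvw_left hU hdU, div_le_iff₀ (by positivity), sum_nbr_comm, card_mul_degree hU hV]
  refine (Finset.sum_le_sum (g := fun _ => B * dV) fun v _ => ?_).trans (le_of_eq ?_)
  · have := h v
    rwa [one_div, inv_mul_eq_div, div_le_iff₀ hdV'] at this
  · simp [Finset.card_univ]
    ring

/-- A mean of squares is nonnegative. -/
lemma Euvw_mul_self_nonneg {ι : Type} [Fintype ι] (p : ι → ℝ) (hp : ∀ r, 0 ≤ p r)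
    (m : U → V → ι → ℝ) :
    0 ≤ Euvw Adj (fun u v w => ∑ r, p r * (m u v r * m u w r)) := by
  unfold Euvw
  refine mul_nonneg (by positivity) (Finset.sum_nonneg fun u _ => mul_nonneg (by positivity) ?_)
  have e : ∑ v ∈ nbr Adj u, ∑ w ∈ nbr Adj u, ∑ r, p r * (m u v r * m u w r)
      = ∑ r, p r * (∑ v ∈ nbr Adj u, m u v r) ^ 2 := by
    simp only [sq, Finset.sum_mul_sum]
    simp only [Finset.mul_sum]
    rw [Finset.sum_comm (s := univ)]
    exact Finset.sum_congr rfl fun v _ => Finset.sum_comm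
  rw [e]
  exact Finset.sum_nonneg fun r _ => mul_nonneg (hp r) (sq_nonneg _)

/-- Decoding: sub-probability weights on the labels of `V` whose projections collide often yield
a good labeling. -/
lemma Euvw_collision_le [Nonempty U] [Nonempty (Fin R)] [Nonempty (Fin L)]
    (π : U → V → Fin R → Fin L) (hU : ∀ u : U, (nbr Adj u).card = dU) (hdU : 0 < dU) {s : ℝ}
    (hs : ∀ (ℓU : U → Fin L) (ℓV : V → Fin R),
      ((univ.filter (fun p : U × V =>
          Adj p.1 p.2 = true ∧ π p.1 p.2 (ℓV p.2) = ℓU p.1)).card : ℝ)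
        ≤ s * ((univ.filter (fun p : U × V => Adj p.1 p.2 = true)).card : ℝ))
    {p : V → Fin R → ℝ} (hp : ∀ v a, 0 ≤ p v a) (hp1 : ∀ v, ∑ a, p v a ≤ 1) :
    Euvw Adj (fun u v w => ∑ i, (∑ a ∈ univ.filter (fun a => π u v a = i), p v a) *
      ∑ a ∈ univ.filter (fun a => π u w a = i), p w a) ≤ s := by
  have hdU' : (0 : ℝ) < dU := by positivity
  have hc : (0 : ℝ) < Fintype.card U := by positivity
  set P : U → V → Fin L → ℝ := fun u v i => ∑ a ∈ univ.filter (fun a => π u v a = i), p v a with hP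
  set S : U → Fin L → ℝ := fun u i => ∑ v ∈ nbr Adj u, P u v i with hS
  have hS0 : ∀ u i, 0 ≤ S u i := fun u i =>
    Finset.sum_nonneg fun v _ => Finset.sum_nonneg fun a _ => hp v a
  have hS1 : ∀ u, ∑ i, S u i ≤ dU := by
    intro u
    rw [hS, Finset.sum_comm, ← hU u, Finset.cast_card]
    refine Finset.sum_le_sum fun v _ => ?_
    rw [hP, Finset.sum_fiberwise]
    exact hp1 v
  choose ℓU hℓU using fun u => Finite.exists_max (S u)
  set n : V → Fin R → ℝ := fun v a =>
    ∑ u ∈ univ.filter (fun u : U => Adj u v = true), if π u v a = ℓU u then 1 else 0 with hn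
  choose ℓV hℓV using fun v => Finite.exists_max (n v)
  have hn0 : ∀ v a, 0 ≤ n v a := fun v a =>
    Finset.sum_nonneg fun u _ => by split_ifs <;> norm_num
  have hlabel : ∑ v, n v (ℓV v) ≤ s * (Fintype.card U * dU) := by
    refine le_trans (le_of_eq ?_) ((hs ℓU ℓV).trans_eq (by rw [card_edges hU]))
    rw [Finset.card_filter, Fintype.sum_prod_type_right]
    push_cast
    refine Finset.sum_congr rfl fun v _ => ?_
    simp only [hn, Finset.sum_filter]
    refine Finset.sum_congr rfl fun u _ => ?_
    split_ifs <;> simp_all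
  have hmax : ∑ u, S u (ℓU u) ≤ s * (Fintype.card U * dU) := by
    refine le_trans ?_ hlabel
    simp only [hS]
    rw [sum_nbr_comm (fun u v => P u v (ℓU u))]
    refine Finset.sum_le_sum fun v _ => ?_
    calc ∑ u ∈ univ.filter (fun u : U => Adj u v = true), P u v (ℓU u)
        = ∑ a, p v a * n v a := by
          simp only [hP, hn, Finset.mul_sum]
          rw [Finset.sum_comm]
          refine Finset.sum_congr rfl fun u _ => ?_
          simp [Finset.sum_filter]
      _ ≤ ∑ a, p v a * n v (ℓV v) :=
          Finset.sum_le_sum fun a _ => mul_le_mul_of_nonneg_left (hℓV v a) (hp v a)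
      _ = (∑ a, p v a) * n v (ℓV v) := by rw [Finset.sum_mul]
      _ ≤ n v (ℓV v) := mul_le_of_le_one_left (hn0 _ _) (hp1 v)
  have hcoll : ∀ u, ∑ v ∈ nbr Adj u, ∑ w ∈ nbr Adj u, ∑ i, P u v i * P u w i
      ≤ S u (ℓU u) * dU := by
    intro u
    calc ∑ v ∈ nbr Adj u, ∑ w ∈ nbr Adj u, ∑ i, P u v i * P u w i
        = ∑ i, S u i * S u i := by
          simp only [hS, Finset.sum_mul_sum]
          rw [Finset.sum_comm (s := univ)]
          exact Finset.sum_congr rfl fun v _ => Finset.sum_comm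
      _ ≤ ∑ i, S u (ℓU u) * S u i :=
          Finset.sum_le_sum fun i _ => mul_le_mul_of_nonneg_right (hℓU u i) (hS0 u i)
      _ = S u (ℓU u) * ∑ i, S u i := by rw [Finset.mul_sum]
      _ ≤ S u (ℓU u) * dU := mul_le_mul_of_nonneg_left (hS1 u) (hS0 _ _)
  calc Euvw Adj (fun u v w => ∑ i, P u v i * P u w i)
      ≤ (1 / (Fintype.card U : ℝ)) * ∑ u, (1 / (dU : ℝ) ^ 2) * (S u (ℓU u) * dU) := by
        unfold Euvw
        refine mul_le_mul_of_nonneg_left (Finset.sum_le_sum fun u _ => ?_) (by positivity)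
        rw [hU]
        exact mul_le_mul_of_nonneg_left (hcoll u) (by positivity)
    _ = (∑ u, S u (ℓU u)) / (Fintype.card U * dU) := by
        rw [← Finset.mul_sum, ← Finset.sum_mul]
        field_simp
    _ ≤ s := by
        rw [div_le_iff₀ (by positivity)]
        exact hmax

end Decoding

section Noise

variable {U : Type} {L R : ℕ}

lemma card_le_two_mul_card_image_basePos (β : Finset (Fin R ⊕ Fin R)) :
    β.card ≤ 2 * (β.image basePos).card := by
  refine Finset.card_le_mul_card_image (f := basePos) β 2 fun j _ => ?_
  refine (Finset.card_le_card (t := {Sum.inl j, Sum.inr j}) ?_).trans Finset.card_le_two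
  intro a ha
  have := (Finset.mem_filter.mp ha).2
  rcases a with a | a <;> simp_all [basePos]

/-- The Fourier mass of `f - smoothing γ f` at `β` that survives a random resampling. -/
lemma sq_one_sub_pow_mul_le {c γ ε τ : ℝ} (hc0 : 0 < c) (hc1 : c ≤ 2) (hγ0 : 0 ≤ γ) (hγ1 : γ ≤ 1)
    (hε0 : 0 < ε) (hε1 : ε ≤ 1) (β : Finset (Fin R ⊕ Fin R)) (ρ : U → Fin R → Fin L) (s : Finset U)
    {a : ℝ} (ha : 0 ≤ a)
    (hsmooth : a * ∑ u ∈ s, (1 : ℝ) / (((β.image basePos).image (ρ u)).card : ℝ)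
      ≤ ((β.image basePos).card : ℝ) ^ (-c)) (hτ : (2 * γ) ^ c / ε ≤ τ) :
    (1 - (1 - γ) ^ β.card) ^ 2 * (a * ∑ u ∈ s, (1 - ε) ^ (blocks (ρ u) β).card) ≤ τ := by
  refine le_trans ?_ hτ
  rcases β.eq_empty_or_nonempty with rfl | hβ
  · simp
    positivity
  have hα : (β.image basePos).Nonempty := hβ.image _
  have hm : (0 : ℝ) < β.card := by exact_mod_cast hβ.card_pos
  have hcard : (β.card : ℝ) / 2 ≤ (β.image basePos).card := by
    rw [div_le_iff₀ (by norm_num), mul_comm]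
    exact_mod_cast card_le_two_mul_card_image_basePos β
  have hu : ∀ u, (1 - ε) ^ (blocks (ρ u) β).card
      ≤ (1 / ε) * ((1 : ℝ) / (((β.image basePos).image (ρ u)).card : ℝ)) := by
    intro u
    have hn : (0 : ℝ) < (((β.image basePos).image (ρ u)).card : ℝ) := by
      exact_mod_cast (hα.image _).card_pos
    rw [one_div_mul_one_div, le_div_iff₀ (by positivity)]
    exact pow_one_sub_mul_le hε0.le hε1 _
  have h1 : a * ∑ u ∈ s, (1 - ε) ^ (blocks (ρ u) β).card ≤ (1 / ε) * ((β.card : ℝ) / 2) ^ (-c) := by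
    calc a * ∑ u ∈ s, (1 - ε) ^ (blocks (ρ u) β).card
        ≤ a * ∑ u ∈ s, (1 / ε) * ((1 : ℝ) / (((β.image basePos).image (ρ u)).card : ℝ)) :=
          mul_le_mul_of_nonneg_left (Finset.sum_le_sum fun u _ => hu u) ha
      _ = (1 / ε) * (a * ∑ u ∈ s, (1 : ℝ) / (((β.image basePos).image (ρ u)).card : ℝ)) := by
          rw [← Finset.mul_sum]; ring
      _ ≤ (1 / ε) * ((β.image basePos).card : ℝ) ^ (-c) :=
          mul_le_mul_of_nonneg_left hsmooth (by positivity)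
      _ ≤ (1 / ε) * ((β.card : ℝ) / 2) ^ (-c) :=
          mul_le_mul_of_nonneg_left
            (Real.rpow_le_rpow_of_nonpos (by positivity) hcard (by linarith)) (by positivity)
  have hx0 : 0 ≤ 1 - (1 - γ) ^ β.card := sub_nonneg.mpr (pow_le_one₀ (by linarith) (by linarith))
  have hx1 : 1 - (1 - γ) ^ β.card ≤ 1 := sub_le_self _ (pow_nonneg (by linarith) _)
  have hx2 : 1 - (1 - γ) ^ β.card ≤ γ * β.card := by
    have := one_add_mul_le_pow (a := -γ) (by linarith) β.card
    rw [← sub_eq_add_neg] at this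
    linarith
  have h2 : (1 - (1 - γ) ^ β.card) ^ 2 ≤ (γ * β.card) ^ c := by
    rw [← Real.rpow_natCast]
    refine (Real.rpow_le_rpow_of_exponent_ge' hx0 hx1 hc0.le ?_).trans
      (Real.rpow_le_rpow hx0 hx2 hc0.le)
    exact_mod_cast hc1
  calc (1 - (1 - γ) ^ β.card) ^ 2 * (a * ∑ u ∈ s, (1 - ε) ^ (blocks (ρ u) β).card)
      ≤ (γ * β.card) ^ c * ((1 / ε) * ((β.card : ℝ) / 2) ^ (-c)) := by
        refine mul_le_mul h2 h1 (mul_nonneg ha (Finset.sum_nonneg fun u _ =>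
          pow_nonneg (by linarith) _)) (by positivity)
    _ = (2 * γ) ^ c / ε := by
        rw [Real.rpow_neg (by positivity), ← Real.inv_rpow (by positivity), mul_left_comm,
          ← Real.mul_rpow (by positivity) (by positivity)]
        have : γ * β.card * (β.card / 2 : ℝ)⁻¹ = 2 * γ := by field_simp
        rw [this]
        ring

lemma mean_survivingMass_le {c γ ε τ : ℝ} (hc0 : 0 < c) (hc1 : c ≤ 2) (hγ0 : 0 ≤ γ) (hγ1 : γ ≤ 1)
    (hε0 : 0 < ε) (hε1 : ε ≤ 1 / 2) (ρ : U → Fin R → Fin L) (s : Finset U)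
    {a : ℝ} (ha : 0 ≤ a)
    (hsmooth : ∀ α : Finset (Fin R), a * ∑ u ∈ s, (1 : ℝ) / ((α.image (ρ u)).card : ℝ)
      ≤ (α.card : ℝ) ^ (-c)) (hτ : (2 * γ) ^ c / ε ≤ τ)
    {f : ((Fin R ⊕ Fin R) → Bool) → ℝ} (hf : ∀ x, f x = 1 ∨ f x = -1) :
    a * ∑ u ∈ s, meanSurvivingMass ε (ρ u) (fun x => f x - smoothing γ f x) ≤ τ := by
  have hcoeff : ∀ β, walshCoeff (fun x => f x - smoothing γ f x) β ^ 2
      = walshCoeff f β ^ 2 * (1 - (1 - γ) ^ β.card) ^ 2 := by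
    intro β
    rw [walshCoeff_sub, walshCoeff_smoothing]
    ring
  calc a * ∑ u ∈ s, meanSurvivingMass ε (ρ u) (fun x => f x - smoothing γ f x)
      ≤ a * ∑ u ∈ s, ∑ β, walshCoeff (fun x => f x - smoothing γ f x) β ^ 2
          * (1 - ε) ^ (blocks (ρ u) β).card :=
        mul_le_mul_of_nonneg_left
          (Finset.sum_le_sum fun u _ => sum_survivingMass_le hε0.le hε1 (ρ u) _) ha
    _ = ∑ β, walshCoeff f β ^ 2 * ((1 - (1 - γ) ^ β.card) ^ 2 *
          (a * ∑ u ∈ s, (1 - ε) ^ (blocks (ρ u) β).card)) := by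
        rw [Finset.sum_comm, Finset.mul_sum]
        refine Finset.sum_congr rfl fun β _ => ?_
        rw [← Finset.mul_sum, hcoeff]
        ring
    _ ≤ ∑ β, walshCoeff f β ^ 2 * τ :=
        Finset.sum_le_sum fun β _ => mul_le_mul_of_nonneg_left
          (sq_one_sub_pow_mul_le hc0 hc1 hγ0 hγ1 hε0 (by linarith) β ρ s ha (hsmooth _) hτ)
          (sq_nonneg _)
    _ = τ := by rw [← Finset.sum_mul, sum_walshCoeff_sq_eq_one hf, one_mul]

/-- The weight of a label read off from the influences of a function. -/
noncomputable def labelWeight (γ : ℝ) (g : ((Fin R ⊕ Fin R) → Bool) → ℝ) (j : Fin R) : ℝ :=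
  γ * (influence (Sum.inl j) g + influence (Sum.inr j) g)

lemma sum_labelWeight (γ : ℝ) (ρ : Fin R → Fin L) (g : ((Fin R ⊕ Fin R) → Bool) → ℝ) (i : Fin L) :
    ∑ j ∈ univ.filter (fun j => ρ j = i), labelWeight γ g j = γ * blockInfluence ρ g i := by
  rw [Finset.sum_filter, blockInfluence, Finset.sum_filter, Fintype.sum_sum_type,
    ← Finset.sum_add_distrib, Finset.mul_sum]
  refine Finset.sum_congr rfl fun j _ => ?_
  simp only [labelWeight, basePos, Sum.elim_inl, Sum.elim_inr, id]
  by_cases h : ρ j = i <;> simp [h]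

end Noise

section Soundness

variable {U V : Type} [Fintype U] [Fintype V] {k L R : ℕ} {Adj : U → V → Bool} {dU dV : ℕ}

/-- The influence term of the test is controlled by the best labeling. -/
lemma sq_mul_Euvw_blockInfluence_le [Nonempty U] (hLR : 0 < L → 0 < R)
    (π : U → V → Fin R → Fin L) (hU : ∀ u : U, (nbr Adj u).card = dU) (hdU : 0 < dU)
    {s : ℝ} (hs0 : 0 ≤ s)
    (hs : ∀ (ℓU : U → Fin L) (ℓV : V → Fin R),
      ((univ.filter (fun p : U × V =>
          Adj p.1 p.2 = true ∧ π p.1 p.2 (ℓV p.2) = ℓU p.1)).card : ℝ)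
        ≤ s * ((univ.filter (fun p : U × V => Adj p.1 p.2 = true)).card : ℝ))
    {γ : ℝ} (hγ0 : 0 ≤ γ) (hγ1 : γ ≤ 1) {g : V → ((Fin R ⊕ Fin R) → Bool) → ℝ}
    (hg : ∀ v x, g v x = 1 ∨ g v x = -1) :
    γ ^ 2 * Euvw Adj (fun u v w => ∑ i, blockInfluence (π u v) (smoothing γ (g v)) i *
      blockInfluence (π u w) (smoothing γ (g w)) i) ≤ s := by
  rcases Nat.eq_zero_or_pos L with rfl | hL
  · simpa [Euvw] using hs0
  have : Nonempty (Fin L) := ⟨⟨0, hL⟩⟩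
  have : Nonempty (Fin R) := ⟨⟨0, hLR hL⟩⟩
  have h := Euvw_collision_le π hU hdU hs (p := fun v => labelWeight γ (smoothing γ (g v)))
    (fun v a => mul_nonneg hγ0 (add_nonneg (influence_nonneg _ _) (influence_nonneg _ _)))
    (fun v => by
      have := sum_influence_smoothing_le hγ0 hγ1 (hg v)
      rw [Fintype.sum_sum_type, ← Finset.sum_add_distrib, Finset.mul_sum] at this
      exact this)
  simp only [sum_labelWeight] at h
  rw [← Euvw_const_mul]
  refine le_trans (le_of_eq ?_) h
  congr 1
  funext u v w
  rw [Finset.mul_sum]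
  exact Finset.sum_congr rfl fun i _ => by ring

/-- Lower bound for the test in terms of the noise parameter and the influences of the smoothed
tables. -/
lemma Euvw_ET2_ge [Nonempty U] {d : ℕ}
    (π : U → V → Fin R → Fin L) (hU : ∀ u : U, (nbr Adj u).card = dU) (hdU : 0 < dU)
    (hV : ∀ v : V, (univ.filter (fun u : U => Adj u v = true)).card = dV) (hdV : 0 < dV)
    (hfib : ∀ (u : U) (v : V) (i : Fin L), (fib π u v i).card = d)
    {c : ℝ} (hc0 : 0 < c) (hc1 : c ≤ 2)
    (hsmooth : ∀ (v : V) (α : Finset (Fin R)),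
      (1 / (dV : ℝ)) * ∑ u ∈ univ.filter (fun u : U => Adj u v = true),
          (1 : ℝ) / ((α.image (π u v)).card : ℝ) ≤ (α.card : ℝ) ^ (-c))
    {ε : ℝ} (hε0 : 0 < ε) (hε1 : ε ≤ 1 / 2) {P0 P1 : (Fin k → Bool) → ℝ}
    (h0 : UniformMarginals P0) (h1 : UniformMarginals P1) (hk : 0 < k)
    {g : V → ((Fin R ⊕ Fin R) → Bool) → ℝ} (hg : ∀ v x, g v x = 1 ∨ g v x = -1)
    {γ : ℝ} (hγ0 : 0 ≤ γ) (hγ1 : γ ≤ 1) {τ : ℝ} (hτ : 0 < τ) (hγτ : (2 * γ) ^ c / ε ≤ τ ^ 2) :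
    -(2 * k * τ) - (2 ^ k * (2 * k)) ^ 2 *
        Euvw Adj (fun u v w => ∑ i, blockInfluence (π u v) (smoothing γ (g v)) i *
          blockInfluence (π u w) (smoothing γ (g w)) i)
      ≤ Euvw Adj (fun u v w => ET2 π ε P0 P1 d u v w
          (fun X Y => ∏ j : Fin k, g v (X j) * g w (Y j))) := by
  have hg1 : ∀ v x, |g v x| ≤ 1 := fun v x => by rcases hg v x with h | h <;> simp [h]
  have hmono := Euvw_mono (Adj := Adj) fun u v w =>
    le_ET2 π hε0.le hε1 h0 h1 hk d u v w hfib hg1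
      (fun v => abs_smoothing_le hγ0 hγ1 (hg1 v)) hτ
  refine le_trans ?_ hmono
  set M : U → V → ℝ := fun u v =>
    meanSurvivingMass ε (π u v) (fun x => g v x - smoothing γ (g v) x) with hM
  have hnoise : Euvw Adj (fun u v _ => M u v) ≤ τ ^ 2 :=
    Euvw_left_le hU hdU hV hdV fun v =>
      mean_survivingMass_le hc0 hc1 hγ0 hγ1 hε0 hε1 (fun u => π u v) _ (by positivity)
        (hsmooth v) hγτ (hg v)
  have hpos := Euvw_mul_self_nonneg (Adj := Adj) (patternProb ε)
    (patternProb_nonneg hε0.le hε1) (fun u v => condMean P0 P1 (π u v) (smoothing γ (g v)))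
  have hB : k * ((τ + Euvw Adj (fun u v _ => M u v) / τ) / 2) ≤ k * τ := by
    have : Euvw Adj (fun u v _ => M u v) / τ ≤ τ := by
      rw [div_le_iff₀ hτ]
      linarith
    gcongr
    linarith
  have hk1 : Euvw Adj (fun u v _ => k * ((τ + M u v / τ) / 2))
      = k * ((τ + Euvw Adj (fun u v _ => M u v) / τ) / 2) := by
    have e : (fun (u : U) (v _w : V) => k * ((τ + M u v / τ) / 2))
        = fun u v _ => k * τ / 2 + (k / τ / 2) * M u v := by
      funext u v w
      ring
    rw [e, Euvw_add, Euvw_const hU hdU, Euvw_const_mul]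
    ring
  have hk2 : Euvw Adj (fun u _ w => k * ((τ + M u w / τ) / 2))
      = k * ((τ + Euvw Adj (fun u v _ => M u v) / τ) / 2) :=
    (Euvw_right hU hdU fun u v => k * ((τ + M u v / τ) / 2)).trans hk1
  simp only [hM] at hk1 hk2 hB
  rw [Euvw_sub, Euvw_sub, Euvw_sub, Euvw_const_mul ((2 ^ k * (2 * (k : ℝ))) ^ 2), hk1, hk2]
  linarith

end Soundness

/-- The exponents balancing the smoothing parameter against the noise rate. -/
lemma two_mul_rpow_div_eq {c₀ s ε : ℝ} (hc : 0 < c₀) (hs : 0 < s) (hε : 0 < ε) :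
    (2 * (s ^ (1 / 8 : ℝ) * ε ^ (1 / (2 * c₀)) / 2)) ^ (2 * c₀) / ε = (s ^ (c₀ / 8)) ^ 2 := by
  rw [mul_div_cancel₀ _ (by norm_num), Real.mul_rpow (by positivity) (by positivity),
    ← Real.rpow_mul hs.le, ← Real.rpow_mul hε.le, one_div_mul_cancel (by positivity),
    Real.rpow_one, mul_div_cancel_right₀ _ hε.ne', ← Real.rpow_natCast, ← Real.rpow_mul hs.le]
  congr 1
  push_cast
  ring

lemma le_of_sq_smoothing_mul_le {c₀ s ε x : ℝ} (hc : 0 < c₀) (hs : 0 < s) (hs1 : s ≤ 1) (hε : 0 < ε)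
    (hε1 : ε ≤ 1) (h : (s ^ (1 / 8 : ℝ) * ε ^ (1 / (2 * c₀)) / 2) ^ 2 * x ≤ s) :
    x ≤ 4 * (s ^ ((1 - 3 * c₀) / 8) / ε ^ (3 / (2 * c₀))) := by
  refine le_of_mul_le_mul_left (h.trans ?_)
    (by positivity : 0 < (s ^ (1 / 8 : ℝ) * ε ^ (1 / (2 * c₀)) / 2) ^ 2)
  have e1 : (s ^ (1 / 8 : ℝ)) ^ 2 * s ^ ((1 - 3 * c₀) / 8) = s ^ (3 / 8 - 3 * c₀ / 8) := by
    rw [← Real.rpow_natCast, ← Real.rpow_mul hs.le, ← Real.rpow_add hs]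
    congr 1
    push_cast
    ring
  have e2 : (ε ^ (1 / (2 * c₀))) ^ 2 / ε ^ (3 / (2 * c₀)) = ε ^ (-(1 / (2 * c₀))) := by
    rw [← Real.rpow_natCast, ← Real.rpow_mul hε.le, ← Real.rpow_sub hε]
    congr 1
    push_cast
    ring
  have e : (s ^ (1 / 8 : ℝ) * ε ^ (1 / (2 * c₀)) / 2) ^ 2 *
      (4 * (s ^ ((1 - 3 * c₀) / 8) / ε ^ (3 / (2 * c₀))))
      = s ^ (3 / 8 - 3 * c₀ / 8) * ε ^ (-(1 / (2 * c₀))) := by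
    rw [← e1, ← e2]
    ring
  rw [e]
  have h1 : s ≤ s ^ (3 / 8 - 3 * c₀ / 8) := by
    conv_lhs => rw [← Real.rpow_one s]
    exact Real.rpow_le_rpow_of_exponent_ge hs hs1 (by linarith)
  have h2 : 1 ≤ ε ^ (-(1 / (2 * c₀))) :=
    Real.one_le_rpow_of_pos_of_le_one_of_nonpos hε hε1 (by
      have : 0 < 1 / (2 * c₀) := by positivity
      linarith)
  exact h1.trans (le_mul_of_one_le_right (by positivity) h2)

/-- soundness of `𝒯₂`: there are an absolute constant `C > 0` and, for every
`k`, a constant `C_k > 0`, such that for every `c₀`-smooth, at-most-`s`-satisfiable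
Label-Cover instance and every family of `±1`-valued tables `g_v` (in particular for the
products `f_{S,v}` arising from `t` assignments and a nonempty `S`),
`E_{u,v,w} E_{𝒯₂}[Π_j g_v(x_j) g_w(y_j)] ≥ −C·k·s^{c₀/8} − C_k·s^{(1−3c₀)/8}/ε^{3/(2c₀)}`. -/
theorem stmt_14 :
    ∃ C : ℝ, 0 < C ∧ ∀ k : ℕ, 2 ≤ k → ∃ Ck : ℝ, 0 < Ck ∧
      ∀ (L R d : ℕ), 0 < d → R = d * L →
      ∀ (U V : Type) [Fintype U] [Fintype V] [Nonempty U] [Nonempty V]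
        (Adj : U → V → Bool) (π : U → V → Fin R → Fin L)
        (dU dV : ℕ), 0 < dU → 0 < dV →
        (∀ u : U, (nbr Adj u).card = dU) →
        (∀ v : V, (univ.filter (fun u : U => Adj u v = true)).card = dV) →
        (∀ (u : U) (v : V) (i : Fin L), (fib π u v i).card = d) →
      ∀ (c₀ : ℝ), 0 < c₀ → c₀ < 1 / 3 →
        (∀ (v : V) (α : Finset (Fin R)),
          (1 / (dV : ℝ)) * ∑ u ∈ univ.filter (fun u : U => Adj u v = true),
              (1 : ℝ) / ((α.image (π u v)).card : ℝ)
            ≤ (α.card : ℝ) ^ (-(2 * c₀))) →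
      ∀ (ε : ℝ), 0 < ε → ε ≤ 1 / 2 →
      ∀ (P0 P1 : (Fin k → Bool) → ℝ),
        (∀ x, 0 ≤ P0 x) → (∀ x, 0 ≤ P1 x) →
        (∑ x, P0 x = 1) → (∑ x, P1 x = 1) →
        (∀ (j : Fin k) (b : Bool),
          ∑ x ∈ univ.filter (fun x : Fin k → Bool => x j = b), P0 x = 1 / 2) →
        (∀ (j : Fin k) (b : Bool),
          ∑ x ∈ univ.filter (fun x : Fin k → Bool => x j = b), P1 x = 1 / 2) →
        (∀ x : Fin k → Bool, P0 x ≠ 0 → Even (univ.filter (fun i => x i = true)).card) →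
        (∀ x : Fin k → Bool, P1 x ≠ 0 → Odd (univ.filter (fun i => x i = true)).card) →
      ∀ (s : ℝ), 0 < s → s < 1 →
        (∀ (ℓU : U → Fin L) (ℓV : V → Fin R),
          ((univ.filter (fun p : U × V =>
              Adj p.1 p.2 = true ∧ π p.1 p.2 (ℓV p.2) = ℓU p.1)).card : ℝ)
            ≤ s * ((univ.filter (fun p : U × V => Adj p.1 p.2 = true)).card : ℝ)) →
      ∀ g : V → ((Fin R ⊕ Fin R) → Bool) → ℝ,
        (∀ v x, g v x = 1 ∨ g v x = -1) →
        Euvw Adj (fun u v w => ET2 π ε P0 P1 d u v w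
            (fun X Y => ∏ j : Fin k, g v (X j) * g w (Y j)))
          ≥ -(C * k * s ^ (c₀ / 8)) - Ck * s ^ ((1 - 3 * c₀) / 8) / ε ^ (3 / (2 * c₀)) := by
  
  refine ⟨2, by norm_num, fun k hk => ?_⟩
  have hk0 : 0 < k := by omega
  refine ⟨(2 ^ k * (2 * k)) ^ 2 * 4, by positivity, ?_⟩
  intro L R d hd hR U V _ _ _ _ Adj π dU dV hdU hdV hU hV hfib c₀ hc0 hc1 hsmooth ε hε0 hε1 P0 P1
    hP0 hP1 hP0s hP1s hP0m hP1m _ _ s hs0 hs1 hs g hg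
  have hs8 : s ^ (1 / 8 : ℝ) ≤ 1 := Real.rpow_le_one hs0.le hs1.le (by norm_num)
  have hε8 : ε ^ (1 / (2 * c₀)) ≤ 1 := Real.rpow_le_one hε0.le (by linarith) (by positivity)
  have hγ1 : s ^ (1 / 8 : ℝ) * ε ^ (1 / (2 * c₀)) / 2 ≤ 1 := by
    have := mul_le_one₀ hs8 (by positivity) hε8
    linarith
  have hLR : 0 < L → 0 < R := fun hL => hR ▸ Nat.mul_pos hd hL
  have hmain := Euvw_ET2_ge π hU hdU hV hdV hfib (c := 2 * c₀) (by positivity) (by linarith)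
    hsmooth hε0 hε1 ⟨hP0, hP0s, hP0m⟩ ⟨hP1, hP1s, hP1m⟩ hk0 hg (by positivity) hγ1
    (τ := s ^ (c₀ / 8)) (by positivity) (two_mul_rpow_div_eq hc0 hs0 hε0).le
  have hinf := le_of_sq_smoothing_mul_le hc0 hs0 hs1.le hε0 (by linarith)
    (sq_mul_Euvw_blockInfluence_le hLR π hU hdU hs0.le hs (by positivity) hγ1 hg)
  have hinf' := mul_le_mul_of_nonneg_left hinf
    (by positivity : (0 : ℝ) ≤ (2 ^ k * (2 * (k : ℝ))) ^ 2)
  refine ge_iff_le.mpr (le_trans (le_of_eq ?_) ((sub_le_sub_left hinf' _).trans hmain))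
  ring
end

section
/- In the setting of the long code test 𝒯₂, suppose the assignments f_1, …, f_t (each f_{i} a family of functions f_{i,v} : {0,1}^{2R} → {0,1}) form a t-covering of the 2k-LIN-CSP instance whose constraints are generated by 𝒯₂, i.e., for every tuple (u, v, w, X, Y) in the support of 𝒯₂ there is some i ∈ {1, …, t} with Σ_{j=1}^k f_{i,v}(x_j) + Σ_{j=1}^k f_{i,w}(y_j) ≡ 1 (mod 2). Then, writing F_{S,v} := Π_{i∈S} (−1)^{f_{i,v}} : {0,1}^{2R} → {−1, +1}, there exists a nonempty S ⊆ {1, …, t} such that E_{u,v,w} E_{(X,Y)∼𝒯₂}[ Π_{j=1}^k F_{S,v}(x_j) F_{S,w}(y_j) ] ≤ −1/(2^t − 1). -/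
open Finset

/-- Columns drawn independently from distributions `D c` have total mass one. -/
lemma sum_prod_columns {C : Type*} [Fintype C] [DecidableEq C] {k : ℕ}
    (D : C → (Fin k → Bool) → ℝ) (hD : ∀ c, ∑ z, D c z = 1) :
    ∑ X : Fin k → C → Bool, ∏ c, D c (fun r => X r c) = 1 := by
  have h1 : ∑ X : Fin k → C → Bool, ∏ c, D c (fun r => X r c)
      = ∑ Z : C → Fin k → Bool, ∏ c, D c (Z c) :=
    Fintype.sum_equiv (Equiv.piComm fun _ _ => Bool) _ _ (fun _ => rfl)
  rw [h1, ← Fintype.prod_sum]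
  simp [hD]

lemma pick_nonneg {k : ℕ} {P0 P1 : (Fin k → Bool) → ℝ} (hP0 : ∀ x, 0 ≤ P0 x)
    (hP1 : ∀ x, 0 ≤ P1 x) (b : Bool) (x : Fin k → Bool) : 0 ≤ pick P0 P1 b x := by
  cases b <;> simp [pick, hP0, hP1]

lemma sum_pick {k : ℕ} {P0 P1 : (Fin k → Bool) → ℝ} (hP0s : ∑ x, P0 x = 1)
    (hP1s : ∑ x, P1 x = 1) (b : Bool) : ∑ x, pick P0 P1 b x = 1 := by
  cases b <;> simp [pick, hP0s, hP1s]

/-- Column distribution in one half of a block: `none` means that nothing is resampled,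
`some h` that the half `h` is resampled uniformly (`false` is unprimed, `true` primed). -/
noncomputable def colDist {k : ℕ} (P0 P1 : (Fin k → Bool) → ℝ) (b : Bool)
    (m : Option Bool) (h : Bool) : (Fin k → Bool) → ℝ :=
  if m = some h then fun _ => (1 : ℝ) / 2 ^ k else pick P0 P1 b

/-- The probability of each resampling mode. -/
noncomputable def modeWeight (ε : ℝ) (m : Option Bool) : ℝ :=
  if m = none then 1 - 2 * ε else ε

lemma sum_colDist {k : ℕ} {P0 P1 : (Fin k → Bool) → ℝ} (hP0s : ∑ x, P0 x = 1)
    (hP1s : ∑ x, P1 x = 1) (b : Bool) (m : Option Bool) (h : Bool) :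
    ∑ x, colDist P0 P1 b m h x = 1 := by
  unfold colDist
  split_ifs
  · simp
  · exact sum_pick hP0s hP1s b

/-- The column distribution at a position of `[R] ⊕ [R]`, given the choices of all blocks. -/
noncomputable def posDist {k L R : ℕ} (P0 P1 : (Fin k → Bool) → ℝ) (p : Fin R → Fin L)
    (b : Fin L → Bool) (m : Fin L → Option Bool) (c : Fin R ⊕ Fin R) : (Fin k → Bool) → ℝ :=
  Sum.elim (fun j => colDist P0 P1 (b (p j)) (m (p j)) false)
    (fun j => colDist P0 P1 (b (p j)) (m (p j)) true) c

lemma sum_posDist {k L R : ℕ} {P0 P1 : (Fin k → Bool) → ℝ} (hP0s : ∑ x, P0 x = 1)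
    (hP1s : ∑ x, P1 x = 1) (p : Fin R → Fin L) (b : Fin L → Bool) (m : Fin L → Option Bool)
    (c : Fin R ⊕ Fin R) : ∑ x, posDist P0 P1 p b m c x = 1 := by
  cases c <;> exact sum_colDist hP0s hP1s _ _ _

section Mass

variable {U V : Type} {k L R d : ℕ} {π : U → V → Fin R → Fin L} {ε : ℝ}
  {P0 P1 : (Fin k → Bool) → ℝ}

/-- The mass of a block as a mixture of products of column distributions. -/
lemma blockM_eq_sum (hfib : ∀ (u : U) (v : V) (i : Fin L), (fib π u v i).card = d)
    (u : U) (v w : V) (i : Fin L) (X Y : Fin k → (Fin R ⊕ Fin R) → Bool) :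
    blockM π ε P0 P1 d u v w i X Y = ∑ a : Bool × Option Bool, (1 / 2 * modeWeight ε a.2) *
      ((∏ j ∈ fib π u v i, colDist P0 P1 a.1 a.2 false (fun r => X r (Sum.inl j)) *
          colDist P0 P1 a.1 a.2 true (fun r => X r (Sum.inr j))) *
        ∏ j ∈ fib π u w i, colDist P0 P1 (!a.1) a.2 false (fun r => Y r (Sum.inl j)) *
          colDist P0 P1 (!a.1) a.2 true (fun r => Y r (Sum.inr j))) := by
  rw [Fintype.sum_prod_type, blockM, Finset.mul_sum]
  refine Finset.sum_congr rfl fun b _ => ?_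
  simp [Fintype.sum_option, modeWeight, colDist, Finset.prod_mul_distrib, hfib]
  ring

lemma massT2_nonneg (hε1 : 0 < ε) (hε2 : ε ≤ 1 / 2) (hP0 : ∀ x, 0 ≤ P0 x)
    (hP1 : ∀ x, 0 ≤ P1 x) (u : U) (v w : V) (X Y : Fin k → (Fin R ⊕ Fin R) → Bool) :
    0 ≤ massT2 π ε P0 P1 d u v w X Y := by
  have hp := pick_nonneg hP0 hP1
  have he : 0 ≤ 1 - 2 * ε := by linarith
  refine Finset.prod_nonneg fun i _ => mul_nonneg (by norm_num) (Finset.sum_nonneg fun b _ => ?_)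
  have hX : ∀ (b : Bool) (s : Finset (Fin R)) (z : Fin R → Fin k → Bool),
      0 ≤ ∏ j ∈ s, pick P0 P1 b (z j) := fun b s z => Finset.prod_nonneg fun j _ => hp b _
  simp only [Finset.prod_mul_distrib]
  have h1 := hX b (fib π u v i) (fun j r => X r (Sum.inl j))
  have h2 := hX b (fib π u v i) (fun j r => X r (Sum.inr j))
  have h3 := hX (!b) (fib π u w i) (fun j r => Y r (Sum.inl j))
  have h4 := hX (!b) (fib π u w i) (fun j r => Y r (Sum.inr j))
  positivity

lemma sum_massT2 (hfib : ∀ (u : U) (v : V) (i : Fin L), (fib π u v i).card = d)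
    (hP0s : ∑ x, P0 x = 1) (hP1s : ∑ x, P1 x = 1) (u : U) (v w : V) :
    ∑ X : Fin k → (Fin R ⊕ Fin R) → Bool, ∑ Y : Fin k → (Fin R ⊕ Fin R) → Bool,
      massT2 π ε P0 P1 d u v w X Y = 1 := by
  have key : ∀ X Y : Fin k → (Fin R ⊕ Fin R) → Bool, massT2 π ε P0 P1 d u v w X Y =
      ∑ g : Fin L → Bool × Option Bool, (∏ i, (1 / 2 * modeWeight ε (g i).2)) *
        ((∏ c, posDist P0 P1 (π u v) (fun i => (g i).1) (fun i => (g i).2) c (fun r => X r c)) *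
          ∏ c, posDist P0 P1 (π u w) (fun i => !(g i).1) (fun i => (g i).2) c
            (fun r => Y r c)) := by
    intro X Y
    simp only [massT2, blockM_eq_sum hfib]
    rw [Fintype.prod_sum]
    refine Finset.sum_congr rfl fun g _ => ?_
    rw [Finset.prod_mul_distrib]
    congr 1
    rw [Finset.prod_mul_distrib]
    have hcol : ∀ (v : V) (b : Fin L → Bool) (Z : Fin k → (Fin R ⊕ Fin R) → Bool),
        (∏ i, ∏ j ∈ fib π u v i, colDist P0 P1 (b i) (g i).2 false (fun r => Z r (Sum.inl j)) *
          colDist P0 P1 (b i) (g i).2 true (fun r => Z r (Sum.inr j))) =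
        ∏ c, posDist P0 P1 (π u v) b (fun i => (g i).2) c (fun r => Z r c) := by
      intro v b Z
      rw [Fintype.prod_sum_type, ← Finset.prod_mul_distrib,
        ← Finset.prod_fiberwise (s := univ) (g := π u v)]
      refine Finset.prod_congr rfl fun i _ => Finset.prod_congr rfl fun j hj => ?_
      have : π u v j = i := by simpa [fib] using hj
      simp [posDist, this]
    rw [hcol v (fun i => (g i).1), hcol w (fun i => !(g i).1)]
  have hw : ∑ a : Bool × Option Bool, (1 / 2 * modeWeight ε a.2) = 1 := by
    simp [Fintype.sum_prod_type, Fintype.sum_option, modeWeight]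
  calc _ = ∑ g : Fin L → Bool × Option Bool, (∏ i, (1 / 2 * modeWeight ε (g i).2)) *
        ((∑ X : Fin k → (Fin R ⊕ Fin R) → Bool, ∏ c, posDist P0 P1 (π u v) (fun i => (g i).1)
            (fun i => (g i).2) c (fun r => X r c)) *
          ∑ Y : Fin k → (Fin R ⊕ Fin R) → Bool, ∏ c, posDist P0 P1 (π u w) (fun i => !(g i).1)
            (fun i => (g i).2) c (fun r => Y r c)) := by
        simp only [key]
        rw [Finset.sum_congr rfl fun X _ => Finset.sum_comm, Finset.sum_comm]
        refine Finset.sum_congr rfl fun g _ => ?_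
        simp only [Finset.sum_mul_sum]
        simp only [Finset.mul_sum]
    _ = ∑ g : Fin L → Bool × Option Bool, ∏ i, (1 / 2 * modeWeight ε (g i).2) := by
        refine Finset.sum_congr rfl fun g _ => ?_
        rw [sum_prod_columns _ (sum_posDist hP0s hP1s _ _ _),
          sum_prod_columns _ (sum_posDist hP0s hP1s _ _ _), mul_one, mul_one]
    _ = 1 := by
        rw [← Fintype.prod_sum (fun (_ : Fin L) (a : Bool × Option Bool) =>
          1 / 2 * modeWeight ε a.2), hw, Finset.prod_const_one]

end Mass

lemma prod_sign_eq {ι : Type*} (s : Finset ι) (a b : ι → Bool) :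
    ∏ j ∈ s, ((if a j = true then (-1 : ℝ) else 1) * (if b j = true then (-1 : ℝ) else 1)) =
      if ∑ j ∈ s, (((if a j = true then 1 else 0) + (if b j = true then 1 else 0) : ZMod 2)) = 1
        then -1 else 1 := by
  classical
  induction s using Finset.induction_on with
  | empty => simp
  | insert j s hj ih =>
    rw [Finset.prod_insert hj, Finset.sum_insert hj, ih]
    generalize ∑ j ∈ s, (((if a j = true then 1 else 0)
      + (if b j = true then 1 else 0) : ZMod 2)) = z
    have h11 : (1 + 1 : ZMod 2) = 0 := by decide
    have hz : ∀ z : ZMod 2, z = 0 ∨ z = 1 := by decide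
    rcases hz z with rfl | rfl <;> cases a j <;> cases b j <;> simp [h11]

/-- If some sign `s i` is `-1`, the products of the signs over nonempty sets sum to `-1`. -/
lemma sum_nonempty_prod_eq_neg_one {ι : Type*} [Fintype ι] [DecidableEq ι] (s : ι → ℝ)
    (hs : ∃ i, s i = -1) :
    ∑ S ∈ univ.filter (fun S : Finset ι => S.Nonempty), ∏ i ∈ S, s i = -1 := by
  have h := Finset.prod_one_add (f := s) (univ : Finset ι)
  obtain ⟨i, hi⟩ := hs
  rw [Finset.prod_eq_zero (mem_univ i) (by rw [hi]; ring), Finset.powerset_univ,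
    ← Finset.sum_filter_add_sum_filter_not univ (fun S : Finset ι => S.Nonempty)] at h
  have h2 : univ.filter (fun S : Finset ι => ¬ S.Nonempty) = {∅} := by
    ext S; simp
  rw [h2, Finset.sum_singleton, Finset.prod_empty] at h
  linarith

lemma Euvw_sum {U V ι : Type} [Fintype U] [Fintype V] (Adj : U → V → Bool) (s : Finset ι)
    (h : ι → U → V → V → ℝ) :
    ∑ S ∈ s, Euvw Adj (h S) = Euvw Adj (fun u v w => ∑ S ∈ s, h S u v w) := by
  simp only [Euvw]
  rw [← Finset.mul_sum, Finset.sum_comm]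
  congr 1
  refine Finset.sum_congr rfl fun u _ => ?_
  rw [← Finset.mul_sum, Finset.sum_comm]
  congr 1
  refine Finset.sum_congr rfl fun v _ => ?_
  rw [Finset.sum_comm]

lemma Euvw_eq_const {U V : Type} [Fintype U] [Fintype V] [Nonempty U] (Adj : U → V → Bool)
    (hne : ∀ u, 0 < (nbr Adj u).card) (h : U → V → V → ℝ) (c : ℝ)
    (hc : ∀ u, ∀ v ∈ nbr Adj u, ∀ w ∈ nbr Adj u, h u v w = c) : Euvw Adj h = c := by
  have h1 : ∀ u, (1 / ((nbr Adj u).card : ℝ) ^ 2) *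
      ∑ v ∈ nbr Adj u, ∑ w ∈ nbr Adj u, h u v w = c := by
    intro u
    rw [Finset.sum_congr rfl fun v hv => Finset.sum_congr rfl (hc u v hv)]
    have : ((nbr Adj u).card : ℝ) ≠ 0 := by exact_mod_cast (hne u).ne'
    simp only [Finset.sum_const, nsmul_eq_mul]
    field_simp
  simp only [Euvw, h1]
  simp

/-- if the assignments `f_1, …, f_t` form a `t`-covering of the
`2k`-LIN-CSP instance generated by the test `𝒯₂` (every constraint in the support is
satisfied, i.e. the `2k` queried bits have odd parity for some `i`), then, writing
`F_{S,v} = Π_{i∈S}(−1)^{f_{i,v}}`, there is a nonempty `S ⊆ {1, …, t}` with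
`E_{u,v,w} E_{𝒯₂}[Π_j F_{S,v}(x_j) F_{S,w}(y_j)] ≤ −1/(2^t − 1)`. -/
theorem stmt_16 (k L R d t : ℕ) (hk : 2 ≤ k) (hd : 0 < d) (hR : R = d * L)
    {U V : Type} [Fintype U] [Fintype V] [Nonempty U] [Nonempty V]
    (Adj : U → V → Bool) (π : U → V → Fin R → Fin L)
    (dU dV : ℕ) (hdU : 0 < dU) (hdV : 0 < dV)
    (hregU : ∀ u : U, (nbr Adj u).card = dU)
    (hregV : ∀ v : V, (univ.filter (fun u : U => Adj u v = true)).card = dV)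
    (hfib : ∀ (u : U) (v : V) (i : Fin L), (fib π u v i).card = d)
    (ε : ℝ) (hε1 : 0 < ε) (hε2 : ε ≤ 1 / 2)
    (P0 P1 : (Fin k → Bool) → ℝ)
    (hP0 : ∀ x, 0 ≤ P0 x) (hP1 : ∀ x, 0 ≤ P1 x)
    (hP0s : ∑ x, P0 x = 1) (hP1s : ∑ x, P1 x = 1)
    (hP0m : ∀ (j : Fin k) (b : Bool),
      ∑ x ∈ univ.filter (fun x : Fin k → Bool => x j = b), P0 x = 1 / 2)
    (hP1m : ∀ (j : Fin k) (b : Bool),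
      ∑ x ∈ univ.filter (fun x : Fin k → Bool => x j = b), P1 x = 1 / 2)
    (hP0p : ∀ x : Fin k → Bool, P0 x ≠ 0 → Even (univ.filter (fun i => x i = true)).card)
    (hP1p : ∀ x : Fin k → Bool, P1 x ≠ 0 → Odd (univ.filter (fun i => x i = true)).card)
    (f : Fin t → V → ((Fin R ⊕ Fin R) → Bool) → Bool)
    (hcover : ∀ (u : U) (v w : V) (X Y : Fin k → (Fin R ⊕ Fin R) → Bool),
      Adj u v = true → Adj u w = true → 0 < massT2 π ε P0 P1 d u v w X Y →
      ∃ i : Fin t,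
        (∑ j : Fin k, (((if f i v (X j) = true then 1 else 0)
          + (if f i w (Y j) = true then 1 else 0) : ZMod 2))) = 1) :
    ∃ S : Finset (Fin t), S.Nonempty ∧
      Euvw Adj (fun u v w => ET2 π ε P0 P1 d u v w
          (fun X Y => ∏ j : Fin k,
            (∏ i ∈ S, if f i v (X j) = true then (-1 : ℝ) else 1) *
            (∏ i ∈ S, if f i w (Y j) = true then (-1 : ℝ) else 1)))
        ≤ -(1 / (2 ^ t - 1)) := by
  classical
  have hne : ∀ u, 0 < (nbr Adj u).card := fun u => by rw [hregU]; exact hdU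
  have ht : 0 < t := by
    by_contra h0
    obtain ⟨u⟩ := ‹Nonempty U›
    obtain ⟨v, hv⟩ := Finset.card_pos.mp (hne u)
    have hv' : Adj u v = true := by simpa [nbr] using hv
    have hz : ∀ X Y, massT2 π ε P0 P1 d u v v X Y = 0 := by
      intro X Y
      by_contra hXY
      obtain ⟨i, -⟩ := hcover u v v X Y hv' hv'
        (lt_of_le_of_ne (massT2_nonneg hε1 hε2 hP0 hP1 u v v X Y) (Ne.symm hXY))
      exact h0 i.pos
    have h1 := sum_massT2 (ε := ε) hfib hP0s hP1s u v v
    simp [hz] at h1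
  set N := univ.filter (fun S : Finset (Fin t) => S.Nonempty) with hN
  have hcard : (N.card : ℝ) = 2 ^ t - 1 := by
    have h1 := Finset.card_filter_add_card_filter_not (s := (univ : Finset (Finset (Fin t))))
      (fun S : Finset (Fin t) => S.Nonempty)
    have h2 : univ.filter (fun S : Finset (Fin t) => ¬ S.Nonempty) = {∅} := by
      ext S; simp
    rw [h2, Finset.card_singleton, Finset.card_univ, Fintype.card_finset, Fintype.card_fin] at h1
    rw [eq_sub_iff_add_eq]
    exact_mod_cast h1
  have hpos : (0 : ℝ) < 2 ^ t - 1 := by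
    have : (1 : ℝ) < 2 ^ t := one_lt_pow₀ (by norm_num) ht.ne'
    linarith
  have hsum : ∑ S ∈ N, Euvw Adj (fun u v w => ET2 π ε P0 P1 d u v w
      (fun X Y => ∏ j : Fin k,
        (∏ i ∈ S, if f i v (X j) = true then (-1 : ℝ) else 1) *
        (∏ i ∈ S, if f i w (Y j) = true then (-1 : ℝ) else 1))) = -1 := by
    rw [Euvw_sum]
    refine Euvw_eq_const Adj hne _ _ fun u v hv w hw => ?_
    have hv' : Adj u v = true := by simpa [nbr] using hv
    have hw' : Adj u w = true := by simpa [nbr] using hw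
    simp only [ET2]
    refine Eq.trans ?_ (congrArg Neg.neg (sum_massT2 (ε := ε) hfib hP0s hP1s u v w))
    rw [Finset.sum_comm, ← Finset.sum_neg_distrib]
    refine Finset.sum_congr rfl fun X _ => ?_
    rw [Finset.sum_comm, ← Finset.sum_neg_distrib]
    refine Finset.sum_congr rfl fun Y _ => ?_
    rw [← Finset.mul_sum]
    rcases (massT2_nonneg (π := π) (d := d) hε1 hε2 hP0 hP1 u v w X Y).eq_or_lt with h0 | h0
    · simp [← h0]
    · have hs : ∀ S ∈ N, (∏ j : Fin k,
          (∏ i ∈ S, if f i v (X j) = true then (-1 : ℝ) else 1) *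
          (∏ i ∈ S, if f i w (Y j) = true then (-1 : ℝ) else 1)) =
          ∏ i ∈ S, ∏ j : Fin k, ((if f i v (X j) = true then (-1 : ℝ) else 1) *
            (if f i w (Y j) = true then (-1 : ℝ) else 1)) := by
        intro S _
        rw [Finset.prod_comm]
        simp only [Finset.prod_mul_distrib]
      rw [Finset.sum_congr rfl hs, sum_nonempty_prod_eq_neg_one]
      · ring
      · obtain ⟨i, hi⟩ := hcover u v w X Y hv' hw' h0
        exact ⟨i, by rw [prod_sign_eq, if_pos hi]⟩
  by_contra! hcon
  have hNne : N.Nonempty := by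
    rw [← Finset.card_pos]
    have : (0 : ℝ) < N.card := by rw [hcard]; exact hpos
    exact_mod_cast this
  have hlt := Finset.sum_lt_sum_of_nonempty hNne fun S hS =>
    hcon S (by simpa [hN] using hS)
  rw [hsum, Finset.sum_const, nsmul_eq_mul, hcard] at hlt
  have : (2 ^ t - 1 : ℝ) * -(1 / (2 ^ t - 1)) = -1 := by field_simp
  linarith
end

section
/- Let 𝒢 be the 4-LIN-CSP instance produced by the long code test 𝒯₃ from a Label-Cover instance G. If G admits a labeling ℓ satisfying all of its edges, then the two assignments f_v(x) := x_{ℓ(v)} and g_v(x) := x_{R+ℓ(v)} satisfy: each of f and g covers at least a 1 − ε fraction of the constraints of 𝒢 (under the test distribution), and for every constraint in the support of 𝒯₃ at least one of f, g covers it; hence {f, g} is a 2-covering of 𝒢. -/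
open Finset

/-! Common setup for the long code test `𝒯₃` (the `4`-LIN test).  Strings in `{0,1}^{2R}`
are indexed by `Fin R ⊕ Fin R` and strings in `{0,1}^{2L}` by `Fin L ⊕ Fin L`, the left
summand being the first half and the right summand the second half. -/

/-- `y ∘ π`: `(y ∘ π)_i = y_{π(i)}` for `i ∈ [R]` and `(y ∘ π)_i = y_{π(i−R)+L}`
otherwise. -/
def compL {L R : ℕ} (π : Fin R → Fin L) (y : (Fin L ⊕ Fin L) → Bool) :
    (Fin R ⊕ Fin R) → Bool :=
  fun c => match c with
  | Sum.inl j => y (Sum.inl (π j))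
  | Sum.inr j => y (Sum.inr (π j))

/-- Probability weight of the `i`-th block of the noise pattern `(η, η')`:
`(η_i, η_{L+i}, η'_i, η'_{L+i})` is `(0,0,0,0)` with probability `1 − 2ε`, `(1,0,1,0)` with
probability `ε`, and `(0,1,0,1)` with probability `ε`. -/
noncomputable def patW {L : ℕ} (ε : ℝ) (η η' : (Fin L ⊕ Fin L) → Bool) (i : Fin L) : ℝ :=
  if η (Sum.inl i) = false ∧ η (Sum.inr i) = false ∧
     η' (Sum.inl i) = false ∧ η' (Sum.inr i) = false then 1 - 2 * ε
  else if η (Sum.inl i) = true ∧ η (Sum.inr i) = false ∧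
          η' (Sum.inl i) = true ∧ η' (Sum.inr i) = false then ε
  else if η (Sum.inl i) = false ∧ η (Sum.inr i) = true ∧
          η' (Sum.inl i) = false ∧ η' (Sum.inr i) = true then ε
  else 0

/-- Probability of the noise pattern `(η, η')` (blocks independent). -/
noncomputable def wprod {L : ℕ} (ε : ℝ) (η η' : (Fin L ⊕ Fin L) → Bool) : ℝ :=
  ∏ i : Fin L, patW ε η η' i

/-- The second queried point `x + y ∘ π + (η ∘ π)·z` of the test `𝒯₃`. -/
def arg2 {L R : ℕ} (π : Fin R → Fin L) (x z : (Fin R ⊕ Fin R) → Bool)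
    (y η : (Fin L ⊕ Fin L) → Bool) : (Fin R ⊕ Fin R) → Bool :=
  fun c => xor (x c) (xor (compL π y c) (compL π η c && z c))

/-- The fourth queried point `x' + y ∘ π + (η' ∘ π)·z' + 1̄` of the test `𝒯₃`. -/
def arg4 {L R : ℕ} (π : Fin R → Fin L) (x' z' : (Fin R ⊕ Fin R) → Bool)
    (y η' : (Fin L ⊕ Fin L) → Bool) : (Fin R ⊕ Fin R) → Bool :=
  fun c => xor (x' c) (xor (compL π y c) (xor (compL π η' c && z' c) true))

/-- The `4`-LIN constraint of the test `𝒯₃` evaluated on the assignment `fA`: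
`f_v(x) + f_v(x + y∘π_{uv} + (η∘π_{uv})·z) + f_w(x') + f_w(x' + y∘π_{uw} + (η'∘π_{uw})·z' + 1̄)
 = 1 (mod 2)`. -/
def accept3 {U V : Type} {L R : ℕ} (π : U → V → Fin R → Fin L)
    (fA : V → ((Fin R ⊕ Fin R) → Bool) → Bool) (u : U) (v w : V)
    (x x' z z' : (Fin R ⊕ Fin R) → Bool) (y η η' : (Fin L ⊕ Fin L) → Bool) : Prop :=
  xor (xor (fA v x) (fA v (arg2 (π u v) x z y η)))
      (xor (fA w x') (fA w (arg4 (π u w) x' z' y η'))) = true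

/-- Expectation over the whole test distribution `𝒯₃`: a uniform `u ∈ U`, uniform
independent neighbors `v, w` of `u`, uniform `x, x', z, z' ∈ {0,1}^{2R}`, a uniform
`y ∈ {0,1}^{2L}` and the noise pattern `(η, η')`. -/
noncomputable def E3 {U V : Type} [Fintype U] [Fintype V] {L R : ℕ}
    (Adj : U → V → Bool) (ε : ℝ)
    (h : U → V → V → ((Fin R ⊕ Fin R) → Bool) → ((Fin R ⊕ Fin R) → Bool) →
      ((Fin R ⊕ Fin R) → Bool) → ((Fin R ⊕ Fin R) → Bool) →
      ((Fin L ⊕ Fin L) → Bool) → ((Fin L ⊕ Fin L) → Bool) → ((Fin L ⊕ Fin L) → Bool) → ℝ) :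
    ℝ :=
  (1 / (Fintype.card U : ℝ)) * ∑ u : U, (1 / ((nbr Adj u).card : ℝ) ^ 2) *
    ∑ v ∈ nbr Adj u, ∑ w ∈ nbr Adj u,
      ((1 : ℝ) / 2 ^ (2 * R)) ^ 4 * ((1 : ℝ) / 2 ^ (2 * L)) *
        ∑ x : (Fin R ⊕ Fin R) → Bool, ∑ x' : (Fin R ⊕ Fin R) → Bool,
        ∑ z : (Fin R ⊕ Fin R) → Bool, ∑ z' : (Fin R ⊕ Fin R) → Bool,
        ∑ y : (Fin L ⊕ Fin L) → Bool,
        ∑ η : (Fin L ⊕ Fin L) → Bool, ∑ η' : (Fin L ⊕ Fin L) → Bool,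
          wprod ε η η' * h u v w x x' z z' y η η'

attribute [local instance] Classical.propDecidable

/-- A sum over pairs of strings of a product over blocks factors into block sums. -/
theorem sum_sum_prod_blocks {L : ℕ} (G : Fin L → Bool → Bool → Bool → Bool → ℝ) :
    ∑ η : (Fin L ⊕ Fin L) → Bool, ∑ η' : (Fin L ⊕ Fin L) → Bool,
      ∏ i, G i (η (Sum.inl i)) (η (Sum.inr i)) (η' (Sum.inl i)) (η' (Sum.inr i)) =
    ∏ i, ∑ q : (Bool × Bool) × (Bool × Bool), G i q.1.1 q.1.2 q.2.1 q.2.2 := by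
  rw [Finset.prod_univ_sum, Fintype.piFinset_univ, ← Fintype.sum_prod_type']
  let e : ((Fin L ⊕ Fin L → Bool) × (Fin L ⊕ Fin L → Bool)) ≃
      (Fin L → (Bool × Bool) × (Bool × Bool)) :=
    { toFun := fun p i => ((p.1 (Sum.inl i), p.1 (Sum.inr i)), (p.2 (Sum.inl i), p.2 (Sum.inr i)))
      invFun := fun q =>
        (Sum.elim (fun i => (q i).1.1) (fun i => (q i).1.2),
          Sum.elim (fun i => (q i).2.1) (fun i => (q i).2.2))
      left_inv := by
        rintro ⟨η, η'⟩
        ext s <;> cases s <;> rfl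
      right_inv := fun q => rfl }
  exact Fintype.sum_equiv e _ _ fun p => rfl

theorem patW_nonneg {L : ℕ} {ε : ℝ} (hε1 : 0 < ε) (hε2 : ε < 1 / 2)
    (η η' : (Fin L ⊕ Fin L) → Bool) (i : Fin L) : 0 ≤ patW ε η η' i := by
  unfold patW
  split_ifs <;> linarith

theorem wprod_nonneg {L : ℕ} {ε : ℝ} (hε1 : 0 < ε) (hε2 : ε < 1 / 2)
    (η η' : (Fin L ⊕ Fin L) → Bool) : 0 ≤ wprod ε η η' :=
  Finset.prod_nonneg fun i _ => patW_nonneg hε1 hε2 η η' i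

/-- At each position, the noise `(η, η')` vanishes with probability `1 - ε`. -/
theorem sum_wprod_mul_indicator {L : ℕ} (ε : ℝ) (s : Fin L ⊕ Fin L) :
    ∑ η : (Fin L ⊕ Fin L) → Bool, ∑ η' : (Fin L ⊕ Fin L) → Bool,
      wprod ε η η' * (if η s = false ∧ η' s = false then 1 else 0) = 1 - ε := by
  let block : Bool → Bool → Bool → Bool → ℝ := fun a b c d =>
    if a = false ∧ b = false ∧ c = false ∧ d = false then 1 - 2 * ε
    else if a = true ∧ b = false ∧ c = true ∧ d = false then ε
    else if a = false ∧ b = true ∧ c = false ∧ d = true then ε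
    else 0
  rcases s with i₀ | i₀
  · have h := sum_sum_prod_blocks (L := L) fun i a b c d =>
      block a b c d * (if i = i₀ then (if a = false ∧ c = false then 1 else 0) else 1)
    simp only [Finset.prod_mul_distrib, Finset.prod_ite_eq', Finset.mem_univ, if_true] at h
    refine h.trans ?_
    rw [Finset.prod_eq_single i₀]
    · simp [Fintype.sum_prod_type, block]
      ring
    · intro i _ hi
      simp [Fintype.sum_prod_type, block, hi]
      ring
    · simp
  · have h := sum_sum_prod_blocks (L := L) fun i a b c d =>
      block a b c d * (if i = i₀ then (if b = false ∧ d = false then 1 else 0) else 1)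
    simp only [Finset.prod_mul_distrib, Finset.prod_ite_eq', Finset.mem_univ, if_true] at h
    refine h.trans ?_
    rw [Finset.prod_eq_single i₀]
    · simp [Fintype.sum_prod_type, block]
      ring
    · intro i _ hi
      simp [Fintype.sum_prod_type, block, hi]
      ring
    · simp

/-- A lower bound on the noise average of `h`, uniform in the remaining choices of the test,
is a lower bound on `E3`. -/
theorem le_E3 {U V : Type} [Fintype U] [Fintype V] [Nonempty U] {L R : ℕ}
    (Adj : U → V → Bool) (hnbr : ∀ u, 0 < (nbr Adj u).card) (ε c : ℝ)
    (h : U → V → V → ((Fin R ⊕ Fin R) → Bool) → ((Fin R ⊕ Fin R) → Bool) →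
      ((Fin R ⊕ Fin R) → Bool) → ((Fin R ⊕ Fin R) → Bool) →
      ((Fin L ⊕ Fin L) → Bool) → ((Fin L ⊕ Fin L) → Bool) → ((Fin L ⊕ Fin L) → Bool) → ℝ)
    (hc : ∀ u, ∀ v ∈ nbr Adj u, ∀ w ∈ nbr Adj u, ∀ x x' z z' y,
      c ≤ ∑ η, ∑ η', wprod ε η η' * h u v w x x' z z' y η η') :
    c ≤ E3 Adj ε h := by
  have key : E3 (L := L) (R := R) Adj ε h ≥
      (1 / (Fintype.card U : ℝ)) * ∑ u : U, (1 / ((nbr Adj u).card : ℝ) ^ 2) *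
        ∑ v ∈ nbr Adj u, ∑ w ∈ nbr Adj u,
          ((1 : ℝ) / 2 ^ (2 * R)) ^ 4 * ((1 : ℝ) / 2 ^ (2 * L)) *
            ∑ _x : (Fin R ⊕ Fin R) → Bool, ∑ _x' : (Fin R ⊕ Fin R) → Bool,
            ∑ _z : (Fin R ⊕ Fin R) → Bool, ∑ _z' : (Fin R ⊕ Fin R) → Bool,
            ∑ _y : (Fin L ⊕ Fin L) → Bool, c := by
    unfold E3
    gcongr with u _ v hv w hw x _ x' _ z _ z' _ y _
    exact hc u v hv w hw x x' z z' y
  refine le_of_eq_of_le ?_ key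
  have hU : (Fintype.card U : ℝ) ≠ 0 := by exact_mod_cast Fintype.card_ne_zero
  have hstrings : ((1 : ℝ) / 2 ^ (2 * R)) ^ 4 * ((1 : ℝ) / 2 ^ (2 * L)) *
            ∑ _x : (Fin R ⊕ Fin R) → Bool, ∑ _x' : (Fin R ⊕ Fin R) → Bool,
            ∑ _z : (Fin R ⊕ Fin R) → Bool, ∑ _z' : (Fin R ⊕ Fin R) → Bool,
            ∑ _y : (Fin L ⊕ Fin L) → Bool, c = c := by
    simp only [Finset.sum_const, Finset.card_univ, Fintype.card_fun, Fintype.card_sum,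
      Fintype.card_fin, Fintype.card_bool, nsmul_eq_mul, Nat.cast_pow, Nat.cast_ofNat, ← two_mul]
    field_simp
  simp only [hstrings]
  have hterm : ∀ u : U, (1 / ((nbr Adj u).card : ℝ) ^ 2) *
      ∑ _v ∈ nbr Adj u, ∑ _w ∈ nbr Adj u, c = c := by
    intro u
    have hu : ((nbr Adj u).card : ℝ) ≠ 0 := by exact_mod_cast (hnbr u).ne'
    simp only [Finset.sum_const, nsmul_eq_mul]
    field_simp
  simp only [hterm]
  simp only [Finset.sum_const, Finset.card_univ, nsmul_eq_mul]
  field_simp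

/-- A dictator assignment covers a constraint whose noise vanishes at the label of `u`. -/
theorem accept3_inl {U V : Type} {L R : ℕ} (π : U → V → Fin R → Fin L) (ℓV : V → Fin R)
    (u : U) (v w : V) (i : Fin L) (hv : π u v (ℓV v) = i) (hw : π u w (ℓV w) = i)
    (x x' z z' : (Fin R ⊕ Fin R) → Bool) (y η η' : (Fin L ⊕ Fin L) → Bool)
    (hη : η (Sum.inl i) = false) (hη' : η' (Sum.inl i) = false) :
    accept3 π (fun v₀ s => s (Sum.inl (ℓV v₀))) u v w x x' z z' y η η' := by
  simp only [accept3, arg2, arg4, compL, hv, hw, hη, hη']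
  cases x (Sum.inl (ℓV v)) <;> cases x' (Sum.inl (ℓV w)) <;> cases y (Sum.inl i) <;> rfl

/-- The analogue of `accept3_inl` for the second half of the coordinates. -/
theorem accept3_inr {U V : Type} {L R : ℕ} (π : U → V → Fin R → Fin L) (ℓV : V → Fin R)
    (u : U) (v w : V) (i : Fin L) (hv : π u v (ℓV v) = i) (hw : π u w (ℓV w) = i)
    (x x' z z' : (Fin R ⊕ Fin R) → Bool) (y η η' : (Fin L ⊕ Fin L) → Bool)
    (hη : η (Sum.inr i) = false) (hη' : η' (Sum.inr i) = false) :
    accept3 π (fun v₀ s => s (Sum.inr (ℓV v₀))) u v w x x' z z' y η η' := by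
  simp only [accept3, arg2, arg4, compL, hv, hw, hη, hη']
  cases x (Sum.inr (ℓV v)) <;> cases x' (Sum.inr (ℓV w)) <;> cases y (Sum.inr i) <;> rfl

/-- In the support of the noise, each block vanishes on one of its two halves. -/
theorem half_block_eq_false_of_wprod_ne_zero {L : ℕ} {ε : ℝ} {η η' : (Fin L ⊕ Fin L) → Bool}
    (h : wprod ε η η' ≠ 0) (i : Fin L) :
    (η (Sum.inl i) = false ∧ η' (Sum.inl i) = false) ∨
      (η (Sum.inr i) = false ∧ η' (Sum.inr i) = false) := by
  have hi : patW ε η η' i ≠ 0 := Finset.prod_ne_zero_iff.mp h i (Finset.mem_univ i)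
  unfold patW at hi
  split_ifs at hi <;> tauto

/-- If `P` holds whenever the noise vanishes at `s`, then `P` has probability at least `1 - ε`
over the noise. -/
theorem one_sub_le_sum_wprod {L : ℕ} {ε : ℝ} (hε1 : 0 < ε) (hε2 : ε < 1 / 2)
    (s : Fin L ⊕ Fin L) (P : ((Fin L ⊕ Fin L) → Bool) → ((Fin L ⊕ Fin L) → Bool) → Prop)
    (hP : ∀ η η', η s = false → η' s = false → P η η') :
    1 - ε ≤ ∑ η, ∑ η', wprod ε η η' * (if P η η' then 1 else 0) := by
  rw [← sum_wprod_mul_indicator ε s]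
  refine Finset.sum_le_sum fun η _ => Finset.sum_le_sum fun η' _ =>
    mul_le_mul_of_nonneg_left ?_ (wprod_nonneg hε1 hε2 η η')
  by_cases hs : η s = false ∧ η' s = false
  · rw [if_pos hs, if_pos (hP η η' hs.1 hs.2)]
  · rw [if_neg hs]
    split_ifs <;> norm_num

/-- completeness of `𝒯₃`: if the Label-Cover instance admits a labeling `ℓ`
satisfying all edges, then the assignments `f_v(x) := x_{ℓ(v)}` and `g_v(x) := x_{R+ℓ(v)}`
each cover at least a `1 − ε` fraction of the constraints of the `4`-LIN-CSP instance `𝒢`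
produced by `𝒯₃`, and every constraint in the support of `𝒯₃` is covered by `f` or by `g`;
hence `{f, g}` is a `2`-covering of `𝒢`. -/
theorem stmt_17 (L R : ℕ)
    {U V : Type} [Fintype U] [Fintype V] [Nonempty U] [Nonempty V]
    (Adj : U → V → Bool) (π : U → V → Fin R → Fin L)
    (dU dV : ℕ) (hdU : 0 < dU) (hdV : 0 < dV)
    (hregU : ∀ u : U, (nbr Adj u).card = dU)
    (hregV : ∀ v : V, (univ.filter (fun u : U => Adj u v = true)).card = dV)
    (ε : ℝ) (hε1 : 0 < ε) (hε2 : ε < 1 / 2)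
    (ℓU : U → Fin L) (ℓV : V → Fin R)
    (hlab : ∀ (u : U) (v : V), Adj u v = true → π u v (ℓV v) = ℓU u) :
    (1 - ε ≤ E3 Adj ε (fun u v w x x' z z' y η η' =>
        if accept3 π (fun v₀ s => s (Sum.inl (ℓV v₀))) u v w x x' z z' y η η'
        then 1 else 0))
    ∧ (1 - ε ≤ E3 Adj ε (fun u v w x x' z z' y η η' =>
        if accept3 π (fun v₀ s => s (Sum.inr (ℓV v₀))) u v w x x' z z' y η η'
        then 1 else 0))
    ∧ (∀ (u : U) (v w : V) (x x' z z' : (Fin R ⊕ Fin R) → Bool)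
        (y η η' : (Fin L ⊕ Fin L) → Bool),
        Adj u v = true → Adj u w = true → 0 < wprod ε η η' →
        accept3 π (fun v₀ s => s (Sum.inl (ℓV v₀))) u v w x x' z z' y η η' ∨
        accept3 π (fun v₀ s => s (Sum.inr (ℓV v₀))) u v w x x' z z' y η η') := by
  have hnbr : ∀ u, 0 < (nbr Adj u).card := fun u => by rw [hregU u]; exact hdU
  have hmem : ∀ {u v}, v ∈ nbr Adj u → π u v (ℓV v) = ℓU u := fun {u v} hv =>
    hlab u v (Finset.mem_filter.mp hv).2
  refine ⟨?_, ?_, ?_⟩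
  · refine le_E3 Adj hnbr ε _ _ fun u v hv w hw x x' z z' y => ?_
    exact one_sub_le_sum_wprod hε1 hε2 (Sum.inl (ℓU u)) _ fun η η' hη hη' =>
      accept3_inl π ℓV u v w _ (hmem hv) (hmem hw) x x' z z' y η η' hη hη'
  · refine le_E3 Adj hnbr ε _ _ fun u v hv w hw x x' z z' y => ?_
    exact one_sub_le_sum_wprod hε1 hε2 (Sum.inr (ℓU u)) _ fun η η' hη hη' =>
      accept3_inr π ℓV u v w _ (hmem hv) (hmem hw) x x' z z' y η η' hη hη'
  · intro u v w x x' z z' y η η' hv hw hpos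
    have hv := hlab u v hv
    have hw := hlab u w hw
    exact (half_block_eq_false_of_wprod_ne_zero hpos.ne' (ℓU u)).imp
      (fun h => accept3_inl π ℓV u v w _ hv hw x x' z z' y η η' h.1 h.2)
      (fun h => accept3_inr π ℓV u v w _ hv hw x x' z z' y η η' h.1 h.2)
end
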